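/- arXiv:1704.04778 — 2 statements merged into one kernel-verified Lean document; each statement's English description precedes it below -/
import Mathlib

section
/- Let c : ℝ^d → ℂ be a function (a formal sum ∑_x c(x) δ_x). Then c is weakly admissible, i.e., for every continuous compactly supported f : ℝ^d → ℂ the family (‖c(χ)‖·‖𝓕⁻¹f(χ)‖²)_{χ ∈ ℝ^d} is summable, if and only if c is translation bounded, i.e., for every compact K ⊆ ℝ^d one has sup_{t ∈ ℝ^d} ∑_{χ ∈ t+K} ‖c(χ)‖ < ∞. -/
open MeasureTheory Metric Filter
open scoped Pointwise FourierTransform RealInnerProductSpace ENNReal Topology SchwartzMap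

noncomputable section
set_option linter.all false
lemma pairing_aux {d : ℕ} (f : EuclideanSpace ℝ (Fin d) → ℂ) (hf : Continuous f)
    (hs : HasCompactSupport f) :
    ∃ (h : Lp ℂ 2 (volume : Measure (EuclideanSpace ℝ (Fin d))))
      (ψ : 𝓢(EuclideanSpace ℝ (Fin d), ℂ)),
      ∀ χ, 𝓕⁻ f χ = ∫ y, ψ (y - χ) * h y := by
  obtain ⟨r, hr⟩ := hs.isCompact.isBounded.subset_closedBall 0
  let b : ContDiffBump (0 : EuclideanSpace ℝ (Fin d)) :=
    { rIn := max r 1, rOut := max r 1 + 1, rIn_pos := by positivity, rIn_lt_rOut := by linarith }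
  have hb1 : ∀ t, f t ≠ 0 → b t = 1 := by
    intro t ht
    apply b.one_of_mem_closedBall
    have := hr (subset_tsupport f ht)
    simp only [mem_closedBall] at this ⊢
    exact this.trans (le_max_left _ _)
  have hbs : HasCompactSupport (fun t => ((b t : ℝ) : ℂ)) := by
    have := b.hasCompactSupport
    exact this.comp_left (g := fun x : ℝ => (x : ℂ)) (by simp)
  have hbc : ContDiff ℝ ((⊤ : ℕ∞)) (fun t => ((b t : ℝ) : ℂ)) :=
    Complex.ofRealCLM.contDiff.comp b.contDiff
  let φ : 𝓢(EuclideanSpace ℝ (Fin d), ℂ) := hbs.toSchwartzMap hbc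
  have hφ : ∀ t, φ t = (b t : ℂ) := fun t => rfl
  have hm : MemLp f 2 volume := hf.memLp_of_hasCompactSupport hs
  refine ⟨𝓕⁻ (hm.toLp f), 𝓕 φ, fun χ => ?_⟩
  set g : 𝓢(EuclideanSpace ℝ (Fin d), ℂ) := (𝓕 φ).compSubConstCLM ℂ χ with hg
  have h1 := congrArg (fun T => T g) (Lp.fourierInv_toTemperedDistribution_eq (hm.toLp f))
  simp only [TemperedDistribution.fourierInv_apply, Lp.toTemperedDistribution_apply] at h1
  have h2 : ∫ y, (𝓕 φ) (y - χ) * (𝓕⁻ (hm.toLp f) : Lp ℂ 2 (volume : Measure (EuclideanSpace ℝ (Fin d)))) y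
     = ∫ y, g y • (𝓕⁻ (hm.toLp f) : Lp ℂ 2 (volume : Measure (EuclideanSpace ℝ (Fin d)))) y := rfl
  rw [h2, ← h1, Real.fourierInv_eq]
  apply integral_congr_ae
  filter_upwards [hm.coeFn_toLp] with t ht
  rw [ht]
  have h3 : (𝓕⁻ g) t = Real.fourierChar ⟪t, χ⟫ • φ t := by
    rw [SchwartzMap.fourierInv_coe, Real.fourierInv_eq]
    have : ∀ v, Real.fourierChar ⟪v, t⟫ • g v =
        (fun u => Real.fourierChar ⟪u + χ, t⟫ • (𝓕 φ : 𝓢(EuclideanSpace ℝ (Fin d), ℂ)) u) (v - χ) := by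
      intro v; simp [hg]
    simp_rw [this]
    rw [integral_sub_right_eq_self (μ := volume) (fun u => Real.fourierChar ⟪u + χ, t⟫ • (𝓕 φ : 𝓢(EuclideanSpace ℝ (Fin d), ℂ)) u) χ]
    have e : φ t = (𝓕⁻ (𝓕 φ : 𝓢(EuclideanSpace ℝ (Fin d), ℂ)) : 𝓢(EuclideanSpace ℝ (Fin d), ℂ)) t := by simp
    rw [e, SchwartzMap.fourierInv_coe, Real.fourierInv_eq]
    simp only [Circle.smul_def, smul_eq_mul]
    rw [← integral_const_mul]
    congr 1; ext u
    rw [← mul_assoc, ← Circle.coe_mul, inner_add_left, AddChar.map_add_eq_mul, mul_comm (Real.fourierChar ⟪u, t⟫), real_inner_comm χ t]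
  rw [h3]
  by_cases h0 : f t = 0
  · simp [h0]
  · rw [hφ, hb1 t h0]; simp [Circle.smul_def]

lemma cs_aux {α : Type*} [MeasurableSpace α] (μ : Measure α) {f g : α → ℝ≥0∞}
    (hf : AEMeasurable f μ) (hg : AEMeasurable g μ) :
    (∫⁻ a, f a * g a ∂μ) ^ 2 ≤ (∫⁻ a, f a ^ 2 ∂μ) * (∫⁻ a, g a ^ 2 ∂μ) := by
  have h := ENNReal.lintegral_mul_le_Lp_mul_Lq μ Real.HolderConjugate.two_two hf hg
  simp only [Pi.mul_apply, ENNReal.rpow_two] at h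
  calc _ ≤ _ := pow_le_pow_left' h 2
    _ = _ := by
      rw [mul_pow]
      simp only [← ENNReal.rpow_natCast, ← ENNReal.rpow_mul]
      norm_num

lemma majorant_aux {d : ℕ} (f : EuclideanSpace ℝ (Fin d) → ℂ) (hf : Continuous f)
    (hs : HasCompactSupport f) :
    ∃ G : EuclideanSpace ℝ (Fin d) → ℝ≥0∞, Measurable G ∧ (∫⁻ z, G z) ≠ ⊤ ∧
      ∀ χ z, dist χ z ≤ 1 → ‖𝓕⁻ f χ‖ₑ ^ 2 ≤ G z := by
  obtain ⟨h, ψ, hψ⟩ := pairing_aux f hf hs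
  -- the weight
  let v : EuclideanSpace ℝ (Fin d) → ℝ≥0∞ := fun x => ENNReal.ofReal (((1 + ‖x‖) ^ (d + 1))⁻¹)
  have hvc : Continuous v := by
    apply ENNReal.continuous_ofReal.comp
    apply Continuous.inv₀ (by fun_prop)
    intro x; positivity
  have hvi : (∫⁻ x, v x ^ 2) ≠ ⊤ := by
    have hi := integrable_one_add_norm (E := EuclideanSpace ℝ (Fin d)) (μ := volume)
      (r := (d : ℝ) + 1) (by simp)
    refine ne_top_of_le_ne_top hi.lintegral_lt_top.ne (lintegral_mono fun x => ?_)
    have e : (1 + ‖x‖) ^ (-((d : ℝ) + 1)) = ((1 + ‖x‖) ^ (d + 1))⁻¹ := by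
      rw [Real.rpow_neg (by positivity)]
      norm_cast
    rw [e]
    have h1 : v x ≤ 1 := by
      simp only [v]
      rw [ENNReal.ofReal_le_one]
      apply inv_le_one_of_one_le₀
      apply one_le_pow₀
      linarith [norm_nonneg x]
    calc v x ^ 2 = v x * v x := sq _
      _ ≤ v x * 1 := by gcongr
      _ = _ := mul_one _
  obtain ⟨C, hC⟩ : ∃ C : ℝ≥0∞, C ≠ ⊤ ∧ ∀ x, ‖ψ x‖ₑ ≤ C * v x ^ 2 := by
    set C0 : ℝ := 2 ^ (2 * (d + 1)) * (Finset.Iic (2 * (d + 1), 0)).sup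
      (fun m => SchwartzMap.seminorm ℝ (E := EuclideanSpace ℝ (Fin d)) (F := ℂ) m.1 m.2) ψ with hC0
    refine ⟨ENNReal.ofReal C0, ENNReal.ofReal_ne_top, fun x => ?_⟩
    have := SchwartzMap.one_add_le_sup_seminorm_apply (𝕜 := ℝ) (m := (2 * (d + 1), 0))
      (le_refl (2 * (d + 1))) (le_refl 0) ψ x
    rw [norm_iteratedFDeriv_zero] at this
    simp only [← hC0] at this
    have hp : 0 < (1 + ‖x‖) ^ (d + 1) := by positivity
    simp only [v]
    rw [← ENNReal.ofReal_pow (by positivity), ← ENNReal.ofReal_mul' (by positivity),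
      ← ofReal_norm_eq_enorm]
    apply ENNReal.ofReal_le_ofReal
    rw [inv_pow, ← div_eq_mul_inv, le_div_iff₀ (by positivity), ← pow_mul, mul_comm]
    rw [mul_comm (d + 1) 2]
    exact this
  obtain ⟨hCt, hC⟩ := hC
  have hv2 : ∀ x y : EuclideanSpace ℝ (Fin d), dist x y ≤ 1 → v x ≤ 2 ^ (d + 1) * v y := by
    intro x y hxy
    have : (2 : ℝ≥0∞) ^ (d + 1) = ENNReal.ofReal (2 ^ (d + 1)) := by
      rw [ENNReal.ofReal_pow (by norm_num)]; simp
    simp only [v]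
    rw [this, ← ENNReal.ofReal_mul (by positivity)]
    apply ENNReal.ofReal_le_ofReal
    rw [← div_eq_mul_inv, inv_eq_one_div, div_le_div_iff₀ (by positivity) (by positivity), one_mul,
      ← mul_pow]
    apply pow_le_pow_left₀ (by positivity)
    have : ‖y‖ ≤ ‖x‖ + dist x y := by
      rw [dist_comm, dist_eq_norm]
      calc ‖y‖ = ‖x + (y - x)‖ := by congr 1; abel
        _ ≤ _ := norm_add_le _ _
    linarith [norm_nonneg x]
  have hHm : AEMeasurable (fun y => ‖h y‖ₑ) volume := (Lp.aestronglyMeasurable h).enorm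
  have hHs : StronglyMeasurable (h : EuclideanSpace ℝ (Fin d) → ℂ) := Lp.stronglyMeasurable h
  have hHi : (∫⁻ y, ‖h y‖ₑ ^ 2) ≠ ⊤ := by
    have := (Lp.memLp h).eLpNorm_lt_top
    have h2 := lintegral_rpow_enorm_lt_top_of_eLpNorm_lt_top (by norm_num) (by norm_num) this
    simpa using h2.ne
  let A : ℝ≥0∞ := C ^ 2 * (2 ^ (d + 1)) ^ 2 * (∫⁻ x, v x ^ 2)
  have hA : A ≠ ⊤ := by
    apply ENNReal.mul_ne_top _ hvi
    apply ENNReal.mul_ne_top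
    · exact ENNReal.pow_ne_top hCt
    · exact ENNReal.pow_ne_top (ENNReal.pow_ne_top (by norm_num))
  have hmm : Measurable (fun p : EuclideanSpace ℝ (Fin d) × EuclideanSpace ℝ (Fin d) =>
      ‖h p.2‖ₑ ^ 2 * v (p.2 - p.1) ^ 2) := by
    have m1 : Measurable (h : EuclideanSpace ℝ (Fin d) → ℂ) := hHs.measurable
    have m2 : Measurable v := hvc.measurable
    have m3 : Measurable (fun p : EuclideanSpace ℝ (Fin d) × EuclideanSpace ℝ (Fin d) =>
      v (p.2 - p.1)) := m2.comp (measurable_snd.sub measurable_fst)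
    have m4 : Measurable (fun p : EuclideanSpace ℝ (Fin d) × EuclideanSpace ℝ (Fin d) =>
      ‖h p.2‖ₑ) := (m1.comp measurable_snd).enorm
    exact (m4.pow_const 2).mul (m3.pow_const 2)
  refine ⟨fun z => A * ∫⁻ y, ‖h y‖ₑ ^ 2 * v (y - z) ^ 2, ?_, ?_, ?_⟩
  · exact (hmm.lintegral_prod_right').const_mul A
  · rw [lintegral_const_mul' _ _ hA]
    apply ENNReal.mul_ne_top hA
    rw [lintegral_lintegral_swap hmm.aemeasurable]
    have : ∀ y, ∫⁻ z, ‖h y‖ₑ ^ 2 * v (y - z) ^ 2 = ‖h y‖ₑ ^ 2 * ∫⁻ x, v x ^ 2 := by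
      intro y
      rw [lintegral_const_mul' _ _ (ENNReal.pow_ne_top enorm_ne_top)]
      congr 1
      exact lintegral_sub_left_eq_self (μ := volume) (fun x => v x ^ 2) y
    simp_rw [this]
    rw [lintegral_mul_const' _ _ hvi]
    exact ENNReal.mul_ne_top hHi hvi
  · intro χ z hχ
    have m5 : Measurable (fun y => v (y - χ)) := hvc.measurable.comp (measurable_id.sub_const χ)
    have s1 : ‖𝓕⁻ f χ‖ₑ ≤ C * ∫⁻ y, (‖h y‖ₑ * v (y - χ)) * v (y - χ) := by
      rw [hψ, ← lintegral_const_mul' _ _ hCt]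
      refine (enorm_integral_le_lintegral_enorm _).trans (lintegral_mono fun y => ?_)
      simp only [enorm_mul]
      calc ‖ψ (y - χ)‖ₑ * ‖h y‖ₑ ≤ (C * v (y - χ) ^ 2) * ‖h y‖ₑ := by gcongr; exact hC _
        _ = _ := by ring
    calc ‖𝓕⁻ f χ‖ₑ ^ 2 ≤ (C * ∫⁻ y, (‖h y‖ₑ * v (y - χ)) * v (y - χ)) ^ 2 := by gcongr
      _ = C ^ 2 * (∫⁻ y, (‖h y‖ₑ * v (y - χ)) * v (y - χ)) ^ 2 := mul_pow _ _ _
      _ ≤ C ^ 2 * ((∫⁻ y, (‖h y‖ₑ * v (y - χ)) ^ 2) * ∫⁻ y, v (y - χ) ^ 2) := by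
        gcongr
        exact cs_aux _ (hHm.mul m5.aemeasurable) m5.aemeasurable
      _ ≤ C ^ 2 * (((2 ^ (d + 1)) ^ 2 * ∫⁻ y, ‖h y‖ₑ ^ 2 * v (y - z) ^ 2) * ∫⁻ y, v y ^ 2) := by
        rw [lintegral_sub_right_eq_self (μ := volume) (fun x => v x ^ 2) χ]
        gcongr
        rw [← lintegral_const_mul' _ _ (ENNReal.pow_ne_top (ENNReal.pow_ne_top (by norm_num)))]
        refine lintegral_mono fun y => ?_
        have := hv2 (y - χ) (y - z) (by
          rw [dist_sub_left]; exact hχ)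
        calc (‖h y‖ₑ * v (y - χ)) ^ 2 ≤ (‖h y‖ₑ * (2 ^ (d + 1) * v (y - z))) ^ 2 := by gcongr
          _ = _ := by ring
      _ = _ := by simp only [A]; ring

lemma backward_aux {d : ℕ} (c : EuclideanSpace ℝ (Fin d) → ℂ)
    (hc : ∀ K : Set (EuclideanSpace ℝ (Fin d)), IsCompact K →
      (⨆ t : EuclideanSpace ℝ (Fin d),
        ∑' χ : (t +ᵥ K : Set (EuclideanSpace ℝ (Fin d))), (‖c χ‖₊ : ℝ≥0∞)) < ⊤)
    (f : EuclideanSpace ℝ (Fin d) → ℂ) (hf : Continuous f) (hs : HasCompactSupport f) :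
    Summable fun χ : EuclideanSpace ℝ (Fin d) => ‖c χ‖ * ‖𝓕⁻ f χ‖ ^ 2 := by
  obtain ⟨G, hGm, hGi, hG⟩ := majorant_aux f hf hs
  have hM := hc (closedBall (0 : EuclideanSpace ℝ (Fin d)) 1) (isCompact_closedBall 0 1)
  set M := (⨆ t : EuclideanSpace ℝ (Fin d),
        ∑' χ : (t +ᵥ closedBall (0 : EuclideanSpace ℝ (Fin d)) 1 : Set (EuclideanSpace ℝ (Fin d))), (‖c χ‖₊ : ℝ≥0∞)) with hMdef
  have hMt : ∀ (F : Finset (EuclideanSpace ℝ (Fin d))) z,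
      ∑ χ ∈ F, (closedBall χ 1).indicator (fun _ => ‖c χ‖ₑ) z ≤ M := by
    intro F z
    refine le_trans ?_ (le_iSup _ z)
    rw [tsum_subtype (z +ᵥ closedBall (0 : EuclideanSpace ℝ (Fin d)) 1) (fun χ => (‖c χ‖₊ : ℝ≥0∞))]
    refine le_trans (Finset.sum_le_sum fun χ _ => ?_) (ENNReal.sum_le_tsum F)
    by_cases hz : z ∈ closedBall χ 1
    · have : χ ∈ z +ᵥ closedBall (0 : EuclideanSpace ℝ (Fin d)) 1 := by
        rw [vadd_closedBall]; simpa [dist_comm] using hz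
      rw [Set.indicator_of_mem hz, Set.indicator_of_mem this]
      exact le_rfl
    · rw [Set.indicator_of_notMem hz]; exact zero_le
  set V := volume (closedBall (0 : EuclideanSpace ℝ (Fin d)) 1) with hV
  have hV0 : V ≠ 0 := (measure_closedBall_pos volume _ one_pos).ne'
  have hVt : V ≠ ⊤ := measure_closedBall_lt_top.ne
  have key : ∀ F : Finset (EuclideanSpace ℝ (Fin d)),
      ∑ χ ∈ F, ‖c χ‖ₑ * ‖𝓕⁻ f χ‖ₑ ^ 2 ≤ (M * ∫⁻ z, G z) / V := by
    intro F
    rw [ENNReal.le_div_iff_mul_le (Or.inl hV0) (Or.inl hVt), Finset.sum_mul]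
    calc ∑ χ ∈ F, ‖c χ‖ₑ * ‖𝓕⁻ f χ‖ₑ ^ 2 * V
        ≤ ∑ χ ∈ F, ∫⁻ z, (closedBall χ 1).indicator (fun _ => ‖c χ‖ₑ) z * G z := by
          refine Finset.sum_le_sum fun χ _ => ?_
          have e : V = volume (closedBall χ 1) := by
            rw [hV, ← Measure.addHaar_closedBall_center volume χ]
          rw [e, ← setLIntegral_const]
          rw [← lintegral_indicator measurableSet_closedBall]
          refine lintegral_mono fun z => ?_
          by_cases hz : z ∈ closedBall χ 1
          · simp only [Set.indicator_of_mem hz]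
            gcongr
            exact hG χ z (by simpa [dist_comm] using hz)
          · simp only [Set.indicator_of_notMem hz]; exact zero_le
      _ = ∫⁻ z, (∑ χ ∈ F, (closedBall χ 1).indicator (fun _ => ‖c χ‖ₑ) z) * G z := by
          rw [← lintegral_finset_sum]
          · simp_rw [Finset.sum_mul]
          · intro χ _
            exact (measurable_const.indicator measurableSet_closedBall).mul hGm
      _ ≤ ∫⁻ z, M * G z := by
          refine lintegral_mono fun z => ?_
          gcongr
          exact hMt F z
      _ = _ := lintegral_const_mul' _ _ hM.ne
  have hfin : (∑' χ, ‖c χ‖ₑ * ‖𝓕⁻ f χ‖ₑ ^ 2) ≠ ⊤ := by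
    rw [ENNReal.tsum_eq_iSup_sum]
    refine ne_top_of_le_ne_top (ENNReal.div_ne_top (ENNReal.mul_ne_top hM.ne hGi) hV0) (iSup_le key)
  have := ENNReal.summable_toReal hfin
  simpa using this

lemma forward_aux {d : ℕ} (c : EuclideanSpace ℝ (Fin d) → ℂ)
    (hc : ∀ f : EuclideanSpace ℝ (Fin d) → ℂ, Continuous f → HasCompactSupport f →
      Summable fun χ : EuclideanSpace ℝ (Fin d) => ‖c χ‖ * ‖𝓕⁻ f χ‖ ^ 2)
    (K : Set (EuclideanSpace ℝ (Fin d))) (hK : IsCompact K) :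
      (⨆ t : EuclideanSpace ℝ (Fin d),
        ∑' χ : (t +ᵥ K : Set (EuclideanSpace ℝ (Fin d))), (‖c χ‖₊ : ℝ≥0∞)) < ⊤ := by
  obtain ⟨R, hR0, hR⟩ := hK.isBounded.subset_closedBall_lt 0 0
  have hρ : 0 < 1 / (2 * Real.pi * R) := by positivity
  let b : ContDiffBump (0 : EuclideanSpace ℝ (Fin d)) :=
    { rIn := 1 / (2 * Real.pi * R) / 2, rOut := 1 / (2 * Real.pi * R), rIn_pos := by positivity,
      rIn_lt_rOut := by linarith }
  have hbcont : Continuous fun t => ((b t : ℝ) : ℂ) := Complex.continuous_ofReal.comp b.continuous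
  have hbs : HasCompactSupport (fun t => ((b t : ℝ) : ℂ)) :=
    b.hasCompactSupport.comp_left (g := fun x : ℝ => (x : ℂ)) (by simp)
  have hbi : Integrable (fun t => b t) (volume : Measure (EuclideanSpace ℝ (Fin d))) := b.integrable
  -- lower bound for the transform on K
  let m : ℝ := Real.cos 1 * ∫ t, b t
  have hm : 0 < m := mul_pos Real.cos_one_pos b.integral_pos
  have hgi : ∀ (g : BoundedContinuousFunction (EuclideanSpace ℝ (Fin d)) ℂ)
      (χ : EuclideanSpace ℝ (Fin d)),
      Integrable (fun t => Real.fourierChar ⟪t, χ⟫ • ((b t : ℂ) * g t)) := by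
    intro g χ
    apply Continuous.integrable_of_hasCompactSupport
    · have := g.continuous
      simp only [Circle.smul_def]
      fun_prop
    · exact (hbs.mul_right (f' := g)).smul_left (f := fun t => Real.fourierChar ⟪t, χ⟫)
  have hlow : ∀ ξ ∈ K, m ≤ ‖𝓕⁻ (fun t => ((b t : ℝ) : ℂ)) ξ‖ := by
    intro ξ hξ
    have hξR : ‖ξ‖ ≤ R := by simpa using hR hξ
    refine le_trans ?_ (Complex.re_le_norm _)
    rw [Real.fourierInv_eq]
    have hi : Integrable (fun t => Real.fourierChar ⟪t, ξ⟫ • ((b t : ℝ) : ℂ)) := by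
      simpa using hgi (BoundedContinuousFunction.const _ 1) ξ
    have hre : (∫ t, Real.fourierChar ⟪t, ξ⟫ • ((b t : ℝ) : ℂ)).re =
        ∫ t, (Real.fourierChar ⟪t, ξ⟫ • ((b t : ℝ) : ℂ)).re :=
      (integral_re (𝕜 := ℂ) hi).symm
    rw [hre]
    simp only [m]
    rw [← integral_const_mul]
    refine integral_mono (hbi.const_mul _) hi.re fun t => ?_
    have e : (Real.fourierChar ⟪t, ξ⟫ • ((b t : ℝ) : ℂ)).re = Real.cos (2 * Real.pi * ⟪t, ξ⟫) * b t := by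
      rw [Circle.smul_def, Real.fourierChar_apply, smul_eq_mul, Complex.re_mul_ofReal,
        Complex.exp_ofReal_mul_I_re]
    change Real.cos 1 * b t ≤ (Real.fourierChar ⟪t, ξ⟫ • ((b t : ℝ) : ℂ)).re
    rw [e]
    by_cases h0 : t ∈ ball (0 : EuclideanSpace ℝ (Fin d)) (1 / (2 * Real.pi * R))
    · refine mul_le_mul_of_nonneg_right ?_ b.nonneg
      rw [← Real.cos_abs (2 * Real.pi * ⟪t, ξ⟫)]
      apply Real.cos_le_cos_of_nonneg_of_le_pi (abs_nonneg _) (by linarith [Real.pi_gt_three])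
      rw [abs_mul, abs_of_pos (by positivity : 0 < 2 * Real.pi)]
      have ht : ‖t‖ ≤ 1 / (2 * Real.pi * R) := by
        have := mem_ball_zero_iff.1 h0
        exact this.le
      calc 2 * Real.pi * |⟪t, ξ⟫| ≤ 2 * Real.pi * (‖t‖ * ‖ξ‖) := by
            gcongr; exact abs_real_inner_le_norm _ _
        _ ≤ 2 * Real.pi * (1 / (2 * Real.pi * R) * R) := by gcongr
        _ = 1 := by field_simp
    · have : b t = 0 := by
        have hsup := b.support_eq
        by_contra hne
        have h5 : t ∈ Function.support b := hne
        rw [hsup] at h5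
        exact h0 h5
      simp [this]
  -- the coefficient functionals
  let L : EuclideanSpace ℝ (Fin d) →
      (BoundedContinuousFunction (EuclideanSpace ℝ (Fin d)) ℂ →L[ℂ] ℂ) := fun χ =>
    LinearMap.mkContinuous
      { toFun := fun g => (Real.sqrt ‖c χ‖ : ℂ) * ∫ t, Real.fourierChar ⟪t, χ⟫ • ((b t : ℂ) * g t)
        map_add' := by
          intro g₁ g₂
          rw [← mul_add, ← integral_add (hgi g₁ χ) (hgi g₂ χ)]
          congr 2; ext t
          simp only [BoundedContinuousFunction.coe_add, Pi.add_apply, mul_add, smul_add]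
        map_smul' := by
          intro a g
          simp only [RingHom.id_apply, smul_eq_mul]
          rw [mul_left_comm, ← integral_const_mul a]
          congr 2; ext t
          simp only [BoundedContinuousFunction.coe_smul, Circle.smul_def, smul_eq_mul]
          ring }
      (Real.sqrt ‖c χ‖ * ∫ t, b t)
      (by
        intro g
        simp only [LinearMap.coe_mk, AddHom.coe_mk, norm_mul]
        rw [mul_assoc]
        have : ‖((Real.sqrt ‖c χ‖ : ℝ) : ℂ)‖ = Real.sqrt ‖c χ‖ := by
          rw [Complex.norm_real, Real.norm_of_nonneg (Real.sqrt_nonneg _)]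
        rw [this]
        gcongr
        rw [← integral_mul_const]
        refine norm_integral_le_of_norm_le (hbi.mul_const _) (Eventually.of_forall fun t => ?_)
        rw [Circle.norm_smul, norm_mul, Complex.norm_real, Real.norm_of_nonneg b.nonneg]
        exact mul_le_mul_of_nonneg_left (g.norm_coe_le_norm t) b.nonneg)
  have hL : ∀ χ g, L χ g = (Real.sqrt ‖c χ‖ : ℂ) * 𝓕⁻ (fun t => (b t : ℂ) * g t) χ := by
    intro χ g
    rw [Real.fourierInv_eq]; rfl
  have hL2 : ∀ χ g, ‖L χ g‖ ^ 2 = ‖c χ‖ * ‖𝓕⁻ (fun t => (b t : ℂ) * g t) χ‖ ^ 2 := by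
    intro χ g
    rw [hL, norm_mul, mul_pow, Complex.norm_real, Real.norm_of_nonneg (Real.sqrt_nonneg _),
      Real.sq_sqrt (norm_nonneg _)]
  let T : Finset (EuclideanSpace ℝ (Fin d)) →
      (BoundedContinuousFunction (EuclideanSpace ℝ (Fin d)) ℂ →L[ℂ]
        lp (fun _ : EuclideanSpace ℝ (Fin d) => ℂ) 2) := fun F =>
    ∑ χ ∈ F, (lp.singleContinuousLinearMap ℂ (fun _ : EuclideanSpace ℝ (Fin d) => ℂ) 2 χ) ∘L (L χ)
  have hT : ∀ F g, ‖T F g‖ ^ 2 = ∑ χ ∈ F, ‖L χ g‖ ^ 2 := by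
    intro F g
    have := lp.norm_sum_single (p := 2) (E := fun _ : EuclideanSpace ℝ (Fin d) => ℂ) (by norm_num)
      (fun χ => L χ g) F
    simp only [ENNReal.toReal_ofNat, Real.rpow_two] at this
    rw [← this]
    simp only [T, ContinuousLinearMap.sum_apply, ContinuousLinearMap.comp_apply,
      lp.singleContinuousLinearMap_apply]
  obtain ⟨C, hC⟩ : ∃ C, ∀ F, ‖T F‖ ≤ C := by
    apply banach_steinhaus
    intro g
    have hsum := hc (fun t => (b t : ℂ) * g t) (hbcont.mul g.continuous) hbs.mul_right
    refine ⟨Real.sqrt (∑' χ, ‖c χ‖ * ‖𝓕⁻ (fun t => (b t : ℂ) * g t) χ‖ ^ 2), fun F => ?_⟩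
    apply Real.le_sqrt_of_sq_le
    rw [hT]
    simp_rw [hL2]
    exact hsum.sum_le_tsum F (fun χ _ => by positivity)
  have hC0 : 0 ≤ C := (norm_nonneg _).trans (hC ∅)
  -- the bound
  have hbound : ∀ (t : EuclideanSpace ℝ (Fin d)) (F : Finset (EuclideanSpace ℝ (Fin d))), (∀ χ ∈ F, χ ∈ t +ᵥ K) →
      ∑ χ ∈ F, ‖c χ‖ ≤ C ^ 2 / m ^ 2 := by
    intro t F hF
    let g : BoundedContinuousFunction (EuclideanSpace ℝ (Fin d)) ℂ :=
      BoundedContinuousFunction.ofNormedAddCommGroup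
        (fun x => ((Real.fourierChar (-⟪x, t⟫) : Circle) : ℂ)) (by fun_prop) 1
        (fun x => (Circle.norm_coe _).le)
    have hg1 : ‖g‖ ≤ 1 := BoundedContinuousFunction.norm_ofNormedAddCommGroup_le _ zero_le_one _
    have hgt : ∀ χ, 𝓕⁻ (fun x => (b x : ℂ) * g x) χ = 𝓕⁻ (fun x => ((b x : ℝ) : ℂ)) (χ - t) := by
      intro χ
      rw [Real.fourierInv_eq, Real.fourierInv_eq]
      congr 1; ext x
      have : g x = ((Real.fourierChar (-⟪x, t⟫) : Circle) : ℂ) := rfl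
      rw [this, inner_sub_right, sub_eq_add_neg, AddChar.map_add_eq_mul]
      simp only [Circle.smul_def, smul_eq_mul, Circle.coe_mul]
      ring
    rw [le_div_iff₀ (by positivity), Finset.sum_mul]
    calc ∑ χ ∈ F, ‖c χ‖ * m ^ 2 ≤ ∑ χ ∈ F, ‖L χ g‖ ^ 2 := by
          refine Finset.sum_le_sum fun χ hχ => ?_
          rw [hL2, hgt]
          have : χ - t ∈ K := by
            obtain ⟨k, hk, rfl⟩ := hF χ hχ
            simpa using hk
          gcongr
          exact hlow _ this
      _ = ‖T F g‖ ^ 2 := (hT F g).symm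
      _ ≤ C ^ 2 := by
          gcongr
          calc ‖T F g‖ ≤ ‖T F‖ * ‖g‖ := (T F).le_opNorm g
            _ ≤ C * 1 := by gcongr; exact hC F
            _ = C := mul_one C
  refine lt_of_le_of_lt (iSup_le fun t => ?_) (ENNReal.ofReal_lt_top (r := C ^ 2 / m ^ 2))
  rw [ENNReal.tsum_eq_iSup_sum]
  refine iSup_le fun F => ?_
  have h1 := hbound t (F.map (Function.Embedding.subtype _)) (by
    intro χ hχ
    simp only [Finset.mem_map, Function.Embedding.subtype_apply] at hχ
    obtain ⟨a, _, rfl⟩ := hχ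
    exact a.2)
  rw [Finset.sum_map] at h1
  refine le_trans (le_of_eq ?_) (ENNReal.ofReal_le_ofReal h1)
  rw [ENNReal.ofReal_sum_of_nonneg (fun _ _ => norm_nonneg _)]
  refine Finset.sum_congr rfl fun χ _ => ?_
  rw [ofReal_norm_eq_enorm]
  rfl

/-- A formal sum `c : ℝ^d → ℂ` is weakly admissible (for every continuous
compactly supported `f`, the family `‖c χ‖·‖𝓕⁻¹f(χ)‖²` is summable) if and only if it is
translation bounded (`sup_t ∑_{χ ∈ t+K} ‖c χ‖ < ∞` for every compact `K`). -/
theorem fourierTransformable_sap_stmt5 {d : ℕ} (c : EuclideanSpace ℝ (Fin d) → ℂ) :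
    (∀ f : EuclideanSpace ℝ (Fin d) → ℂ, Continuous f → HasCompactSupport f →
      Summable fun χ : EuclideanSpace ℝ (Fin d) => ‖c χ‖ * ‖𝓕⁻ f χ‖ ^ 2) ↔
    (∀ K : Set (EuclideanSpace ℝ (Fin d)), IsCompact K →
      (⨆ t : EuclideanSpace ℝ (Fin d),
        ∑' χ : (t +ᵥ K : Set (EuclideanSpace ℝ (Fin d))), (‖c χ‖₊ : ℝ≥0∞)) < ⊤) := by
  exact ⟨fun h K hK => forward_aux c h K hK, fun h f hf hs => backward_aux c h f hf hs⟩
end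
end

section
/- Let μ be a positive, translation bounded, strongly almost periodic Radon measure on ℝ^d, and let c : ℝ^d → ℂ be its Fourier–Bohr coefficients, i.e., assume that for every χ ∈ ℝ^d the limit lim_{R→∞} vol(B_R)⁻¹ ∫_{B_R} e^{−2πi⟨χ,t⟩} dμ(t) exists and equals c(χ), where B_R is the open ball of radius R centered at 0. Then the following are equivalent: (a) c is translation bounded, i.e., for every compact K ⊆ ℝ^d, sup_{t ∈ ℝ^d} ∑_{χ ∈ t+K} ‖c(χ)‖ < ∞; (b) μ is Fourier transformable with Fourier transform equal to its Fourier–Bohr series ∑_χ c(χ) δ_χ, meaning: for every continuous compactly supported f : ℝ^d → ℂ, the family (‖c(χ)‖·‖𝓕⁻¹f(χ)‖²)_χ is summable and ∫_{ℝ^d} (f * f̃)(t) dμ(t) = ∑_{χ ∈ ℝ^d} c(χ) · ‖𝓕⁻¹f(χ)‖². -/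
open MeasureTheory Metric Filter
open scoped Pointwise FourierTransform RealInnerProductSpace ENNReal Topology

noncomputable section

/-- A bounded continuous function is Bohr (strongly) almost periodic if its set of translates is
totally bounded in the supremum norm (expressed via finite `ε`-nets of translates). -/
def IsBohrAlmostPeriodic {d : ℕ} (F : EuclideanSpace ℝ (Fin d) → ℂ) : Prop :=
  Continuous F ∧ (∃ C : ℝ, ∀ t, ‖F t‖ ≤ C) ∧
    ∀ ε : ℝ, 0 < ε → ∃ S : Finset (EuclideanSpace ℝ (Fin d)),
      ∀ s : EuclideanSpace ℝ (Fin d), ∃ s₀ ∈ S,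
        ∀ t : EuclideanSpace ℝ (Fin d), ‖F (t - s) - F (t - s₀)‖ ≤ ε

/-- `c χ` is the Fourier–Bohr coefficient of `μ` at `χ`: the limit of
`vol(B_R)⁻¹ ∫_{B_R} e^{-2πi⟪χ,t⟫} dμ(t)` as `R → ∞`. -/
def IsFourierBohrCoeff {d : ℕ} (μ : Measure (EuclideanSpace ℝ (Fin d)))
    (χ : EuclideanSpace ℝ (Fin d)) (a : ℂ) : Prop :=
  Tendsto (fun R : ℝ =>
      ((volume (ball (0 : EuclideanSpace ℝ (Fin d)) R)).toReal)⁻¹ •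
        ∫ t in ball (0 : EuclideanSpace ℝ (Fin d)) R,
          Complex.exp (((-(2 * Real.pi * ⟪χ, t⟫)) : ℝ) * Complex.I) ∂μ)
    atTop (𝓝 a)


/-! ### Characters and Plancherel -/

section Helpers

set_option linter.unusedSectionVars false

open scoped Convolution

variable {E : Type*} [NormedAddCommGroup E] [InnerProductSpace ℝ E] [FiniteDimensional ℝ E]
  [MeasurableSpace E] [BorelSpace E]

/-- The character `t ↦ e^{2πi⟪χ,t⟫}`. -/
def ech (χ t : E) : ℂ := Complex.exp (((2 * Real.pi * ⟪χ, t⟫ : ℝ) : ℂ) * Complex.I)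

theorem ech_norm (χ t : E) : ‖ech χ t‖ = 1 := Complex.norm_exp_ofReal_mul_I _

theorem ech_add_right (χ s t : E) : ech χ (s + t) = ech χ s * ech χ t := by
  unfold ech
  rw [← Complex.exp_add, inner_add_right]
  congr 1
  push_cast
  ring

theorem ech_add_left (χ ξ t : E) : ech (χ + ξ) t = ech χ t * ech ξ t := by
  unfold ech
  rw [← Complex.exp_add, inner_add_left]
  congr 1
  push_cast
  ring

theorem ech_zero_right (χ : E) : ech χ 0 = 1 := by simp [ech]

theorem ech_zero_left (χ : E) : ech 0 χ = 1 := by simp [ech]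

theorem ech_neg_right (χ t : E) : ech χ (-t) = ech (-χ) t := by simp [ech]

theorem ech_conj (χ t : E) : (starRingEnd ℂ) (ech χ t) = ech (-χ) t := by
  unfold ech
  rw [← Complex.exp_conj, map_mul, Complex.conj_ofReal, Complex.conj_I, inner_neg_left]
  congr 1
  push_cast
  ring

theorem ech_neg_mul (χ t : E) : ech (-χ) t * ech χ t = 1 := by
  rw [← ech_add_left]; simp [ech_zero_left]

theorem ech_continuous : Continuous fun p : E × E => ech p.1 p.2 := by
  unfold ech; fun_prop

@[fun_prop]
theorem ech_continuous' {X : Type*} [TopologicalSpace X] {f g : X → E} (hf : Continuous f)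
    (hg : Continuous g) : Continuous fun x => ech (f x) (g x) :=
  ech_continuous.comp (hf.prodMk hg)

theorem ech_sub_one_le (χ t : E) : ‖ech χ t - 1‖ ≤ 2 * Real.pi * (‖χ‖ * ‖t‖) := by
  unfold ech
  have h := Real.norm_exp_I_mul_ofReal_sub_one_le (x := 2 * Real.pi * ⟪χ, t⟫)
  rw [mul_comm Complex.I] at h
  refine h.trans ?_
  rw [norm_mul, Real.norm_of_nonneg (by positivity)]
  gcongr
  exact norm_inner_le_norm χ t

theorem fourier_eq_ech (f : E → ℂ) (χ : E) : 𝓕 f χ = ∫ t, ech (-χ) t * f t := by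
  rw [Real.fourier_eq']
  congr 1; ext t
  simp [ech, real_inner_comm]

theorem fourierInv_eq_ech (f : E → ℂ) (χ : E) : 𝓕⁻ f χ = ∫ t, ech χ t * f t := by
  rw [Real.fourierInv_eq']
  congr 1; ext t
  simp [ech, real_inner_comm]

theorem fourierInv_eq_fourier (f : E → ℂ) (χ : E) : 𝓕⁻ f χ = 𝓕 f (-χ) := by
  rw [fourier_eq_ech, fourierInv_eq_ech, neg_neg]

theorem ech_continuous_fourier {f : E → ℂ} (hf : Integrable f) :
    Continuous (fun χ => 𝓕 f χ) := by
  simp_rw [fourier_eq_ech]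
  refine continuous_of_dominated (bound := fun t => ‖f t‖) ?_ ?_ hf.norm ?_
  · intro χ
    exact (by fun_prop : Continuous fun t => ech (-χ) t).aestronglyMeasurable.mul hf.1
  · intro χ
    exact Eventually.of_forall fun t => by simp [ech_norm]
  · exact Eventually.of_forall fun t => by fun_prop

theorem lintegral_sq_eq_eLpNorm (f : E → ℂ) : ∫⁻ x, ‖f x‖ₑ ^ 2 = (eLpNorm f 2 volume) ^ 2 := by
  have h := eLpNorm_nnreal_pow_eq_lintegral (μ := (volume : Measure E)) (f := f) (p := 2)
    (by norm_num)
  simp only [NNReal.coe_ofNat, ENNReal.rpow_ofNat] at h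
  exact h.symm

/-- Plancherel for `L¹ ∩ L²`. -/
theorem plancherel_aux {f : E → ℂ} (h1 : Integrable f) (h2 : MemLp f 2) :
    ∫⁻ χ, ‖𝓕 f χ‖ₑ ^ 2 = ∫⁻ t, ‖f t‖ₑ ^ 2 := by
  set F : Lp ℂ 2 (volume : Measure E) := h2.toLp f with hF
  have key : ∀ᵐ x, (𝓕 F : Lp ℂ 2 (volume : Measure E)) x = 𝓕 f x := by
    apply ae_eq_of_integral_contDiff_smul_eq
    · exact (Lp.memLp _).locallyIntegrable (by norm_num)
    · exact (ech_continuous_fourier h1).locallyIntegrable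
    · intro g g_smooth g_cpt
      have hg₁ : HasCompactSupport (Complex.ofRealCLM ∘ g) := g_cpt.comp_left rfl
      have hg₂ : ContDiff ℝ (⊤ : ℕ∞) (Complex.ofRealCLM ∘ g) := by fun_prop
      set φ := hg₁.toSchwartzMap hg₂ with hφ
      have h := congrArg (fun T => T φ) (Lp.fourier_toTemperedDistribution_eq F)
      simp only [TemperedDistribution.fourier_apply, Lp.toTemperedDistribution_apply] at h
      calc ∫ x, g x • (𝓕 F : Lp ℂ 2 (volume : Measure E)) x
          = ∫ x, φ x • (𝓕 F : Lp ℂ 2 (volume : Measure E)) x := by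
            congr 1
        _ = ∫ x, (𝓕 φ) x • F x := h.symm
        _ = ∫ x, (𝓕 (φ : E → ℂ)) x • f x := by
            apply integral_congr_ae
            filter_upwards [h2.coeFn_toLp] with x hx
            rw [hF, hx, SchwartzMap.fourier_coe]
        _ = ∫ x, φ x • 𝓕 f x := by
            exact VectorFourier.integral_fourierIntegral_smul_eq_flip (L := innerₗ E)
              (f := (φ : E → ℂ)) (g := f) Real.continuous_fourierChar
              continuous_inner φ.integrable h1 |>.trans (by rw [flip_innerₗ]; rfl)
        _ = ∫ x, g x • 𝓕 f x := by
            congr 1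
  rw [lintegral_sq_eq_eLpNorm, lintegral_sq_eq_eLpNorm, ← eLpNorm_congr_ae key]
  congr 1
  have := Lp.norm_fourier_eq F
  rw [Lp.norm_def, Lp.norm_def, ENNReal.toReal_eq_toReal_iff' (Lp.eLpNorm_ne_top _)
    (Lp.eLpNorm_ne_top _)] at this
  rw [this]
  exact eLpNorm_congr_ae h2.coeFn_toLp

theorem plancherel {f : E → ℂ} (hf : Continuous f) (hf' : HasCompactSupport f) :
    ∫⁻ χ, ‖𝓕 f χ‖ₑ ^ 2 = ∫⁻ t, ‖f t‖ₑ ^ 2 :=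
  plancherel_aux (hf.integrable_of_hasCompactSupport hf') (hf.memLp_of_hasCompactSupport hf')

theorem conv_L2_le {f g : E → ℂ} (hf : Continuous f) (hf' : HasCompactSupport f)
    (hg : Continuous g) (hg' : HasCompactSupport g) {M : ℝ} (hM : ∀ χ, ‖𝓕 g χ‖ ≤ M) :
    ∫⁻ x, ‖∫ y, f y * g (x - y)‖ₑ ^ 2 ≤ ENNReal.ofReal M ^ 2 * ∫⁻ x, ‖f x‖ₑ ^ 2 := by
  have h1 := hf.integrable_of_hasCompactSupport hf' (μ := volume)
  have h2 := hg.integrable_of_hasCompactSupport hg' (μ := volume)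
  have hc : Continuous (f ⋆[ContinuousLinearMap.mul ℂ ℂ] g) :=
    hg'.continuous_convolution_right _ hf.locallyIntegrable hg
  have hc' : HasCompactSupport (f ⋆[ContinuousLinearMap.mul ℂ ℂ] g) :=
    hf'.convolution _ hg'
  have := plancherel hc hc'
  calc ∫⁻ x, ‖∫ y, f y * g (x - y)‖ₑ ^ 2
      = ∫⁻ x, ‖(f ⋆[ContinuousLinearMap.mul ℂ ℂ] g) x‖ₑ ^ 2 := rfl
    _ = ∫⁻ χ, ‖𝓕 (f ⋆[ContinuousLinearMap.mul ℂ ℂ] g) χ‖ₑ ^ 2 := this.symm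
    _ ≤ ∫⁻ χ, ENNReal.ofReal M ^ 2 * ‖𝓕 f χ‖ₑ ^ 2 := by
        apply lintegral_mono
        intro χ
        simp only [Real.fourier_mul_convolution_eq h1 h2 χ, enorm_mul, mul_pow]
        rw [mul_comm]
        gcongr
        rw [← ofReal_norm]
        exact ENNReal.ofReal_le_ofReal (hM χ)
    _ = _ := by
        rw [lintegral_const_mul' _ _ (by finiteness), plancherel hf hf']


/-! ### Tent averages -/

/-- The tent function. -/
def tent (s : E) : ℝ := max 0 (1 - ‖s‖)

@[fun_prop]
theorem tent_continuous : Continuous (tent : E → ℝ) := by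
  unfold tent; fun_prop

theorem tent_nonneg (s : E) : 0 ≤ tent s := le_max_left _ _

theorem tent_le_one (s : E) : tent s ≤ 1 := by
  unfold tent; apply max_le zero_le_one; linarith [norm_nonneg s]

theorem tent_zero_of {s : E} (h : 1 ≤ ‖s‖) : tent s = 0 := by
  unfold tent; apply max_eq_left; linarith

theorem tent_ge (s : E) : 1 - ‖s‖ ≤ tent s := le_max_right _ _

theorem tent_lip (s t : E) : |tent s - tent t| ≤ ‖s - t‖ := by
  unfold tent
  rw [max_comm 0, max_comm 0]
  refine (abs_max_sub_max_le_abs _ _ _).trans ?_ |>.trans (abs_norm_sub_norm_le t s) |>.trans ?_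
  · rw [show 1 - ‖s‖ - (1 - ‖t‖) = ‖t‖ - ‖s‖ by ring]
  · rw [norm_sub_rev]

theorem tent_hcs : HasCompactSupport (tent : E → ℝ) := by
  apply HasCompactSupport.of_support_subset_isCompact (isCompact_closedBall (0 : E) 1)
  intro s hs
  by_contra h
  apply hs
  apply tent_zero_of
  simp at h
  exact h.le

theorem tent_integrable : Integrable (tent : E → ℝ) :=
  tent_continuous.integrable_of_hasCompactSupport tent_hcs

variable (E) in
/-- The integral of the tent. -/
def vT : ℝ := ∫ s : E, tent s

theorem vT_pos : 0 < vT E := by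
  apply tent_continuous.integral_pos_of_hasCompactSupport_nonneg_nonzero tent_hcs
    (fun s => tent_nonneg s) (x := (0 : E))
  simp [tent]

/-- Integrability of products with the tent. -/
theorem tent_mul_integrable {H : E → ℂ} (hH : Continuous H) :
    Integrable fun s => (tent s : ℂ) * H s := by
  apply Continuous.integrable_of_hasCompactSupport
  · have := tent_continuous (E := E)
    fun_prop
  · have : HasCompactSupport fun s : E => (tent s : ℂ) := by
      exact tent_hcs.comp_left (g := fun x : ℝ => (x : ℂ)) (by simp)
    exact this.mul_right

theorem tent_mul_bound {H : E → ℂ} {D : ℝ} (hD : ∀ s, ‖H s‖ ≤ D) :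
    ‖∫ s, (tent s : ℂ) * H s‖ ≤ D * vT E := by
  unfold vT
  rw [← integral_const_mul]
  apply norm_integral_le_of_norm_le (tent_integrable.const_mul D)
  refine Eventually.of_forall fun s => ?_
  rw [norm_mul, Complex.norm_real, Real.norm_of_nonneg (tent_nonneg s), mul_comm]
  gcongr
  · exact tent_nonneg s
  · exact hD s

/-- Tent averages of `G` at scale `R`, frequency `η`, base point `x`. -/
def uav (G : E → ℂ) (R : ℝ) (η x : E) : ℂ :=
  ∫ s, (tent s : ℂ) * (G (x + R • s) * ech (-η) (R • s))

variable {G : E → ℂ} {C : ℝ}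

theorem uav_bound (hC : ∀ t, ‖G t‖ ≤ C) (R : ℝ) (η x : E) : ‖uav G R η x‖ ≤ C * vT E := by
  apply tent_mul_bound
  intro s
  rw [norm_mul, ech_norm, mul_one]
  exact hC _

theorem uav_sub_le (hG : Continuous G) (R : ℝ) (η x x' : E) {D : ℝ}
    (h : ∀ t, ‖G (x + t) - G (x' + t)‖ ≤ D) : ‖uav G R η x - uav G R η x'‖ ≤ D * vT E := by
  unfold uav
  rw [← integral_sub (tent_mul_integrable (by fun_prop)) (tent_mul_integrable (by fun_prop))]
  simp_rw [← mul_sub, ← sub_mul]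
  apply tent_mul_bound
  intro s
  rw [norm_mul, ech_norm, mul_one]
  exact h _

theorem uav_continuous (hG : Continuous G) (hC : ∀ t, ‖G t‖ ≤ C) (R : ℝ) (η : E) :
    Continuous (uav G R η) := by
  unfold uav
  refine continuous_of_dominated (bound := fun s => tent s * C) ?_ ?_
    (tent_integrable.mul_const C) ?_
  · intro x
    exact (tent_mul_integrable (by fun_prop)).1
  · intro x
    refine Eventually.of_forall fun s => ?_
    rw [norm_mul, norm_mul, ech_norm, mul_one, Complex.norm_real,
      Real.norm_of_nonneg (tent_nonneg s)]
    exact mul_le_mul_of_nonneg_left (hC _) (tent_nonneg s)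
  · exact Eventually.of_forall fun s => by fun_prop

variable (E) in
/-- A volume constant. -/
def kT : ℝ := (volume (closedBall (0 : E) 2)).toReal

theorem kT_nonneg : 0 ≤ kT E := ENNReal.toReal_nonneg

/-- Quasi-invariance of tent averages. -/
theorem uav_shift (hG : Continuous G) (hC : ∀ t, ‖G t‖ ≤ C) {R : ℝ} (hR : 0 < R) (η x y : E)
    (hy : ‖y‖ ≤ R) :
    ‖uav G R η (x + y) - ech η y * uav G R η x‖ ≤ C * kT E * (‖y‖ / R) := by
  have hC0 : 0 ≤ C := (norm_nonneg _).trans (hC 0)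
  set z : E := R⁻¹ • y with hz
  have hzy : R • z = y := by rw [hz, smul_smul, mul_inv_cancel₀ hR.ne', one_smul]
  have hzn : ‖z‖ = ‖y‖ / R := by
    rw [hz, norm_smul, norm_inv, Real.norm_of_nonneg hR.le]; ring
  have hz1 : ‖z‖ ≤ 1 := by rw [hzn]; exact (div_le_one hR).2 hy
  have e1 : uav G R η (x + y) =
      ∫ s, ech η y * ((tent (s - z) : ℂ) * (G (x + R • s) * ech (-η) (R • s))) := by
    unfold uav
    rw [← integral_sub_right_eq_self _ z]
    congr 1; ext s
    have : R • (s - z) = R • s + (-y) := by rw [smul_sub, hzy, sub_eq_add_neg]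
    rw [this, ech_add_right, ech_neg_right, neg_neg]
    rw [show x + y + (R • s + -y) = x + R • s by abel]
    ring
  have i1 : Integrable fun s => (tent (s - z) : ℂ) * (G (x + R • s) * ech (-η) (R • s)) := by
    have := (tent_mul_integrable (H := fun s => (G (x + R • (s + z)) * ech (-η) (R • (s + z))))
      (by fun_prop)).comp_sub_right z
    simpa using this
  rw [e1, integral_const_mul, ← mul_sub, norm_mul, ech_norm, one_mul]
  unfold uav
  rw [← integral_sub i1 (tent_mul_integrable (by fun_prop))]
  have hb : ∀ s, ‖(tent (s - z) : ℂ) * (G (x + R • s) * ech (-η) (R • s)) -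
      (tent s : ℂ) * (G (x + R • s) * ech (-η) (R • s))‖ ≤
      (closedBall (0 : E) 2).indicator (fun _ => C * (‖y‖ / R)) s := by
    intro s
    rw [← sub_mul, norm_mul, norm_mul, ech_norm, mul_one]
    by_cases hs : s ∈ closedBall (0 : E) 2
    · rw [Set.indicator_of_mem hs, mul_comm C]
      refine mul_le_mul ?_ (hC _) (norm_nonneg _) (by positivity)
      rw [← Complex.ofReal_sub, Complex.norm_real, ← hzn]
      refine (tent_lip _ _).trans ?_
      simp
    · rw [Set.indicator_of_notMem hs]
      simp at hs
      have : 1 ≤ ‖s - z‖ := by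
        have := norm_sub_norm_le s z
        linarith
      rw [tent_zero_of this, tent_zero_of (by linarith : 1 ≤ ‖s‖)]
      simp
  refine (norm_integral_le_of_norm_le ?_ (Eventually.of_forall hb)).trans ?_
  · exact (integrable_indicator_iff measurableSet_closedBall).2
      (integrableOn_const (by finiteness [(isCompact_closedBall (0 : E) 2).measure_lt_top (μ := volume)]))
  · rw [integral_indicator measurableSet_closedBall, setIntegral_const]
    apply le_of_eq
    simp only [kT, Measure.real, smul_eq_mul]
    ring

/-- Almost periodicity through finite nets of translates. -/
def NetAP (G : E → ℂ) : Prop :=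
  ∀ ε : ℝ, 0 < ε → ∃ S : Finset E, ∀ x, ∃ s ∈ S, ∀ t, ‖G (x + t) - G (s + t)‖ ≤ ε

theorem NetAP.unif (hG : Continuous G) (h : NetAP G) {ε : ℝ} (hε : 0 < ε) :
    ∃ ρ > 0, ∀ y : E, ‖y‖ < ρ → ∀ x, ‖G (y + x) - G (0 + x)‖ ≤ ε := by
  obtain ⟨S, hS⟩ := h (ε / 3) (by positivity)
  have h1 : ∀ᶠ y in 𝓝 (0 : E), ∀ s ∈ S, ‖G (s + y) - G (s + 0)‖ < ε / 3 := by
    rw [Finset.eventually_all]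
    intro s _
    have : Continuous fun y => ‖G (s + y) - G (s + 0)‖ := by fun_prop
    have h2 := this.tendsto 0
    simp only [sub_self, norm_zero] at h2
    exact h2.eventually_lt_const (by positivity)
  obtain ⟨ρ, hρ, hb⟩ := Metric.eventually_nhds_iff.1 h1
  refine ⟨ρ, hρ, fun y hy x => ?_⟩
  obtain ⟨s, hs, hst⟩ := hS x
  have a1 := hst y
  have a2 := hst 0
  have a3 := hb (by simpa using hy) s hs
  rw [add_comm y x, add_comm 0 x]
  have : G (x + y) - G (x + 0) = (G (x + y) - G (s + y)) + (G (s + y) - G (s + 0)) -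
    (G (x + 0) - G (s + 0)) := by ring
  rw [this]
  refine (norm_sub_le _ _).trans ?_
  have := norm_add_le (G (x + y) - G (s + y)) (G (s + y) - G (s + 0))
  linarith


/-! ### Uniform smallness of tent averages -/

theorem uav_def (G : E → ℂ) (R : ℝ) (η x : E) : uav G R η x =
    ∫ s, (tent s : ℂ) * (G (x + R • s) * ech (-η) (R • s)) := rfl

theorem uav_high (hG : Continuous G) (hC : ∀ t, ‖G t‖ ≤ C) (h : NetAP G) {δ : ℝ} (hδ : 0 < δ) :
    ∃ Λ : ℝ, ∀ R : ℝ, 1 ≤ R → ∀ η : E, Λ < ‖η‖ → ‖uav G R η 0‖ < δ := by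
  have hC0 : 0 ≤ C := (norm_nonneg _).trans (hC 0)
  have hv := vT_pos (E := E)
  have hk := kT_nonneg (E := E)
  obtain ⟨ρ, hρ, hu⟩ := h.unif hG (ε := δ / (2 * vT E)) (by positivity)
  set b : ℝ := min (min ρ 1) (δ / (2 * (C * kT E + 1))) with hb
  have hb0 : 0 < b := by positivity
  refine ⟨1 / b, fun R hR η hη => ?_⟩
  have hη0 : 0 < ‖η‖ := lt_trans (by positivity) hη
  set y : E := (1 / (2 * ‖η‖ ^ 2)) • η with hy
  have hyn : ‖y‖ = 1 / (2 * ‖η‖) := by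
    rw [hy, norm_smul, Real.norm_of_nonneg (by positivity)]
    field_simp
  have hyb : ‖y‖ < b := by
    rw [hyn]
    have : 1 / ‖η‖ < b := by
      rw [div_lt_iff₀ hη0]; rw [div_lt_iff₀ hb0] at hη; linarith
    refine lt_of_le_of_lt ?_ this
    apply one_div_le_one_div_of_le hη0; linarith
  have he : ech η y = -1 := by
    unfold ech
    have : 2 * Real.pi * ⟪η, y⟫ = Real.pi := by
      rw [hy, inner_smul_right, real_inner_self_eq_norm_sq]
      field_simp
    rw [this, Complex.exp_pi_mul_I]
  have hy1 : ‖y‖ ≤ R := (hyb.le.trans ((min_le_left _ _).trans (min_le_right _ _))).trans hR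
  have a1 := uav_shift hG hC (by linarith : 0 < R) η 0 y hy1
  have a2 := uav_sub_le hG R η y 0 (hu y (hyb.trans_le ((min_le_left _ _).trans (min_le_left _ _))))
  rw [zero_add, he] at a1
  have a3 : δ / (2 * vT E) * vT E = δ / 2 := by field_simp
  rw [a3] at a2
  have a4 : C * kT E * (‖y‖ / R) ≤ δ / 2 := by
    have h1 : ‖y‖ / R ≤ δ / (2 * (C * kT E + 1)) :=
      (div_le_self (norm_nonneg _) hR).trans (hyb.le.trans (min_le_right _ _))
    calc C * kT E * (‖y‖ / R) ≤ (C * kT E + 1) * (δ / (2 * (C * kT E + 1))) := by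
          gcongr
          linarith
      _ = δ / 2 := by
          have : C * kT E + 1 ≠ 0 := by positivity
          field_simp
  have e : (2 : ℂ) * uav G R η 0 = (uav G R η y - -1 * uav G R η 0) -
      (uav G R η y - uav G R η 0) := by ring
  have := norm_sub_le (uav G R η y - -1 * uav G R η 0) (uav G R η y - uav G R η 0)
  rw [← e, norm_mul] at this
  simp only [Complex.norm_ofNat] at this
  linarith

theorem uav_double (hG : Continuous G) (hC : ∀ t, ‖G t‖ ≤ C) {η : E}
    (h0 : Tendsto (fun R => uav G R η 0) atTop (𝓝 0)) (R₁ : ℝ) (η₁ : E) :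
    Tendsto (fun R => uav (uav G R₁ η₁) R η 0) atTop (𝓝 0) := by
  have hC0 : 0 ≤ C := (norm_nonneg _).trans (hC 0)
  have hy : ∀ y, Tendsto (fun R => uav G R η y) atTop (𝓝 0) := by
    intro y
    have h1 : Tendsto (fun R => uav G R η y - ech η y * uav G R η 0) atTop (𝓝 0) := by
      apply squeeze_zero_norm' (a := fun R => C * kT E * (‖y‖ / R))
      · filter_upwards [eventually_gt_atTop 0, eventually_ge_atTop ‖y‖] with R hR hR'
        simpa using uav_shift hG hC hR η 0 y hR'
      · have := (tendsto_const_nhds (x := ‖y‖)).div_atTop (tendsto_id (α := ℝ) (x := atTop))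
        simpa using this.const_mul (C * kT E)
    have h2 := h1.add (h0.const_mul (ech η y))
    simpa using h2
  have e : ∀ R, uav (uav G R₁ η₁) R η 0 =
      ∫ s', (tent s' : ℂ) * (ech (-η₁) (R₁ • s') * uav G R η (R₁ • s')) := by
    intro R
    have e1 : ∀ s, (tent s : ℂ) * (uav G R₁ η₁ (0 + R • s) * ech (-η) (R • s)) =
        ∫ s', ((tent s : ℂ) * ech (-η) (R • s)) *
          ((tent s' : ℂ) * (G (R • s + R₁ • s') * ech (-η₁) (R₁ • s'))) := by
      intro s
      rw [integral_const_mul, zero_add]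
      unfold uav; ring
    have e2 : ∀ s', (tent s' : ℂ) * (ech (-η₁) (R₁ • s') * uav G R η (R₁ • s')) =
        ∫ s, ((tent s : ℂ) * ech (-η) (R • s)) *
          ((tent s' : ℂ) * (G (R • s + R₁ • s') * ech (-η₁) (R₁ • s'))) := by
      intro s'
      unfold uav
      rw [← integral_const_mul, ← integral_const_mul]
      congr 1; ext s
      rw [add_comm (R • s)]
      ring
    simp_rw [e2]
    rw [uav_def (uav G R₁ η₁)]
    simp_rw [e1]
    apply integral_integral_swap
    have hb : Integrable (fun p : E × E => (tent p.1 * (tent p.2 * C)))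
        ((volume : Measure E).prod (volume : Measure E)) :=
      tent_integrable.mul_prod (tent_integrable.mul_const C)
    refine hb.mono' ?_ ?_
    · apply Continuous.aestronglyMeasurable
      have := tent_continuous (E := E)
      simp only [Function.uncurry_def]
      fun_prop
    · refine Eventually.of_forall fun p => ?_
      simp only [Function.uncurry_def, norm_mul, ech_norm, Complex.norm_real,
        Real.norm_of_nonneg (tent_nonneg _), mul_one]
      have := tent_nonneg p.1
      have := tent_nonneg p.2
      gcongr
      exact hC _
  simp_rw [e]
  have := tendsto_integral_filter_of_dominated_convergence
    (μ := (volume : Measure E)) (l := (atTop : Filter ℝ))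
    (F := fun R s' => (tent s' : ℂ) * (ech (-η₁) (R₁ • s') * uav G R η (R₁ • s')))
    (f := fun _ => 0) (fun s' => tent s' * (C * vT E)) ?_ ?_
    (tent_integrable.mul_const _) ?_
  · simpa using this
  · refine Eventually.of_forall fun R => ?_
    have := uav_continuous hG hC R η
    exact (tent_mul_integrable (by fun_prop)).1
  · refine Eventually.of_forall fun R => Eventually.of_forall fun s => ?_
    rw [norm_mul, norm_mul, ech_norm, one_mul, Complex.norm_real,
      Real.norm_of_nonneg (tent_nonneg s)]
    exact mul_le_mul_of_nonneg_left (uav_bound hC _ _ _) (tent_nonneg s)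
  · refine Eventually.of_forall fun s => ?_
    have := ((hy (R₁ • s)).const_mul (ech (-η₁) (R₁ • s))).const_mul (tent s : ℂ)
    simpa using this

theorem uav_unif (hG : Continuous G) (hC : ∀ t, ‖G t‖ ≤ C) (h : NetAP G)
    (h0 : ∀ η, Tendsto (fun R => uav G R η 0) atTop (𝓝 0)) {δ : ℝ} (hδ : 0 < δ) :
    ∀ᶠ R in atTop, ∀ η : E, ‖uav G R η 0‖ < δ := by
  by_contra hcon
  have hC0 : 0 ≤ C := (norm_nonneg _).trans (hC 0)
  have hv := vT_pos (E := E)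
  have hk := kT_nonneg (E := E)
  have hex : ∀ n : ℕ, ∃ R : ℝ, ∃ η : E, (n : ℝ) + 1 ≤ R ∧ δ ≤ ‖uav G R η 0‖ := by
    intro n
    by_contra hne
    push Not at hne
    apply hcon
    filter_upwards [eventually_ge_atTop ((n : ℝ) + 1)] with R hR η
    exact hne R η hR
  choose R η hR hbig using hex
  have hR1 : ∀ n, 1 ≤ R n := fun n => by
    have := hR n
    have : (0 : ℝ) ≤ n := by positivity
    linarith
  obtain ⟨Λ, hΛ⟩ := uav_high hG hC h hδ
  have hηΛ : ∀ n, ‖η n‖ ≤ Λ := by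
    intro n
    by_contra hn
    have := hΛ (R n) (hR1 n) (η n) (not_le.1 hn)
    exact absurd (hbig n) (not_le.2 this)
  have hcomp : IsCompact (closedBall (0 : E) Λ ×ˢ closedBall (0 : ℂ) (C * vT E)) :=
    (isCompact_closedBall _ _).prod (isCompact_closedBall _ _)
  obtain ⟨⟨ηl, a⟩, -, φ, hφ, hlim⟩ := hcomp.tendsto_subseq
    (x := fun n => (η n, uav G (R n) (η n) 0)) (fun n => by
      simp only [Set.mem_prod, mem_closedBall, dist_zero_right]
      exact ⟨hηΛ n, uav_bound hC _ _ _⟩)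
  have l1 : Tendsto (fun n => η (φ n)) atTop (𝓝 ηl) :=
    (continuous_fst.tendsto _).comp hlim
  have l2 : Tendsto (fun n => uav G (R (φ n)) (η (φ n)) 0) atTop (𝓝 a) :=
    (continuous_snd.tendsto _).comp hlim
  have lR : Tendsto (fun n => R (φ n)) atTop atTop := by
    refine Tendsto.comp (g := R) ?_ hφ.tendsto_atTop
    refine tendsto_atTop_mono (fun n => ?_) (tendsto_natCast_atTop_atTop (R := ℝ))
    have := hR n
    linarith
  have ha : δ ≤ ‖a‖ := ge_of_tendsto l2.norm (Eventually.of_forall fun n => hbig _)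
  have lx : ∀ x, Tendsto (fun n => uav G (R (φ n)) (η (φ n)) x) atTop (𝓝 (ech ηl x * a)) := by
    intro x
    have h1 : Tendsto (fun n => uav G (R (φ n)) (η (φ n)) x -
        ech (η (φ n)) x * uav G (R (φ n)) (η (φ n)) 0) atTop (𝓝 0) := by
      apply squeeze_zero_norm' (a := fun n => C * kT E * (‖x‖ / R (φ n)))
      · filter_upwards [lR.eventually_gt_atTop 0, lR.eventually_ge_atTop ‖x‖] with n hn hn'
        simpa using uav_shift hG hC hn (η (φ n)) 0 x hn'
      · have := (tendsto_const_nhds (x := ‖x‖)).div_atTop lR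
        simpa using this.const_mul (C * kT E)
    have h2 : Tendsto (fun n => ech (η (φ n)) x) atTop (𝓝 (ech ηl x)) :=
      ((by fun_prop : Continuous fun ξ : E => ech ξ x).tendsto _).comp l1
    simpa using h1.add (h2.mul l2)
  -- uniform closeness
  set ε : ℝ := δ / (2 * (1 + 2 * vT E)) with hε
  have hε0 : 0 < ε := by positivity
  obtain ⟨S, hS⟩ := h ε hε0
  have hev : ∀ᶠ n in atTop, ∀ s ∈ S, ‖uav G (R (φ n)) (η (φ n)) s - ech ηl s * a‖ < ε := by
    rw [Finset.eventually_all]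
    intro s _
    have := (lx s).sub_const (ech ηl s * a)
    rw [sub_self] at this
    have := this.norm
    rw [norm_zero] at this
    exact this.eventually_lt_const hε0
  obtain ⟨n, hn⟩ := hev.exists
  have hunif : ∀ x, ‖uav G (R (φ n)) (η (φ n)) x - ech ηl x * a‖ ≤ (1 + 2 * vT E) * ε := by
    intro x
    obtain ⟨s, hs, hst⟩ := hS x
    have b1 := uav_sub_le hG (R (φ n)) (η (φ n)) x s hst
    have b2 := (hn s hs).le
    have b3 : ‖ech ηl x * a - ech ηl s * a‖ ≤ ε * vT E :=
      le_of_tendsto ((lx x).sub (lx s)).norm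
        (Eventually.of_forall fun m => uav_sub_le hG (R (φ m)) (η (φ m)) x s hst)
    have e : uav G (R (φ n)) (η (φ n)) x - ech ηl x * a =
      (uav G (R (φ n)) (η (φ n)) x - uav G (R (φ n)) (η (φ n)) s) +
      (uav G (R (φ n)) (η (φ n)) s - ech ηl s * a) - (ech ηl x * a - ech ηl s * a) := by ring
    rw [e]
    refine (norm_sub_le _ _).trans ?_
    have := norm_add_le (uav G (R (φ n)) (η (φ n)) x - uav G (R (φ n)) (η (φ n)) s)
      (uav G (R (φ n)) (η (φ n)) s - ech ηl s * a)
    linarith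
  have hd := uav_double hG hC (h0 ηl) (R (φ n)) (η (φ n))
  have hcu := uav_continuous hG hC (R (φ n)) (η (φ n))
  have hav : ∀ r, ‖uav (uav G (R (φ n)) (η (φ n))) r ηl 0 - a * vT E‖ ≤
      ((1 + 2 * vT E) * ε) * vT E := by
    intro r
    have e : a * vT E = ∫ s : E, (tent s : ℂ) * a := by
      rw [integral_mul_const, mul_comm, vT, integral_complex_ofReal]
    rw [e]
    rw [uav_def (uav G (R (φ n)) (η (φ n)))]
    rw [← integral_sub (tent_mul_integrable (by fun_prop)) (tent_mul_integrable (by fun_prop))]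
    simp_rw [← mul_sub]
    apply tent_mul_bound
    intro s
    have := hunif (0 + r • s)
    have e2 : uav G (R (φ n)) (η (φ n)) (0 + r • s) * ech (-ηl) (r • s) - a =
        (uav G (R (φ n)) (η (φ n)) (0 + r • s) - ech ηl (0 + r • s) * a) * ech (-ηl) (r • s) := by
      rw [sub_mul, zero_add]
      have := ech_neg_mul ηl (r • s)
      linear_combination a * this
    rw [e2, norm_mul, ech_norm, mul_one]
    exact this
  have hfin := le_of_tendsto (hd.sub_const (a * vT E)).norm (Eventually.of_forall hav)
  rw [zero_sub, norm_neg, norm_mul, Complex.norm_real, Real.norm_of_nonneg hv.le] at hfin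
  have := le_of_mul_le_mul_right hfin hv
  have e : (1 + 2 * vT E) * ε = δ / 2 := by
    rw [hε]; field_simp
  linarith


/-! ### Uniqueness theorem for almost periodic functions -/

/-- Tent averages of `‖G‖²`. -/
def qav (G : E → ℂ) (r : ℝ) (y : E) : ℝ := ∫ s, tent s * ‖G (y + r • s)‖ ^ 2

theorem tent_mul_integrable_real {H : E → ℝ} (hH : Continuous H) :
    Integrable fun s => tent s * H s := by
  apply Continuous.integrable_of_hasCompactSupport
  · have := tent_continuous (E := E)
    fun_prop
  · exact tent_hcs.mul_right

theorem qav_lower (hG : Continuous G) (hC : ∀ t, ‖G t‖ ≤ C) (h : NetAP G) {x₀ : E}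
    (hx₀ : G x₀ ≠ 0) : ∃ q > 0, ∀ᶠ r in atTop, q ≤ qav G r 0 := by
  have hv := vT_pos (E := E)
  have hk := kT_nonneg (E := E)
  have hκ : 0 < ‖G x₀‖ := norm_pos_iff.2 hx₀
  set κ := ‖G x₀‖ with hκd
  obtain ⟨S, hS⟩ := h (κ / 2) (by positivity)
  have hne : S.Nonempty := by
    obtain ⟨s, hs, -⟩ := hS 0
    exact ⟨s, hs⟩
  have hcard : 0 < (S.card : ℝ) := by exact_mod_cast hne.card_pos
  set G2 : E → ℂ := fun t => ((‖G t‖ ^ 2 : ℝ) : ℂ) with hG2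
  have hG2c : Continuous G2 := by fun_prop
  have hG2b : ∀ t, ‖G2 t‖ ≤ C ^ 2 := by
    intro t
    rw [hG2, Complex.norm_real, Real.norm_of_nonneg (by positivity)]
    gcongr
    exact hC t
  have hq : ∀ r y, ((qav G r y : ℝ) : ℂ) = uav G2 r 0 y := by
    intro r y
    rw [qav, uav_def, ← integral_complex_ofReal]
    congr 1; ext s
    simp [hG2, ech_zero_left]
  have hlow : ∀ r, vT E * (κ / 2) ^ 2 ≤ ∑ s ∈ S, qav G r (x₀ - s) := by
    intro r
    unfold qav vT
    rw [← integral_mul_const, ← integral_finsetSum]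
    · apply integral_mono
      · exact tent_integrable.mul_const _
      · exact integrable_finsetSum _ fun s _ => tent_mul_integrable_real (by fun_prop)
      · intro z
        simp only
        rw [← Finset.mul_sum]
        apply mul_le_mul_of_nonneg_left _ (tent_nonneg z)
        obtain ⟨s, hs, hst⟩ := hS (r • z)
        have h1 := hst (x₀ - s)
        have e : s + (x₀ - s) = x₀ := by abel
        rw [e] at h1
        have h2 : κ / 2 ≤ ‖G (x₀ - s + r • z)‖ := by
          rw [add_comm]
          have := norm_sub_norm_le (G x₀) (G (r • z + (x₀ - s)))
          rw [norm_sub_rev] at this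
          linarith
        calc (κ / 2) ^ 2 ≤ ‖G (x₀ - s + r • z)‖ ^ 2 := by gcongr
          _ ≤ _ := Finset.single_le_sum (f := fun s => ‖G (x₀ - s + r • z)‖ ^ 2)
            (fun _ _ => by positivity) hs
    · exact fun s _ => tent_mul_integrable_real (by fun_prop)
  have hlim : Tendsto (fun r => ∑ s ∈ S, (qav G r (x₀ - s) - qav G r 0)) atTop (𝓝 0) := by
    suffices hz : Tendsto (fun r => ∑ s ∈ S, (qav G r (x₀ - s) - qav G r 0)) atTop
        (𝓝 (∑ s ∈ S, (0 : ℝ))) by simpa using hz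
    apply tendsto_finsetSum
    intro s _
    apply squeeze_zero_norm' (a := fun R => C ^ 2 * kT E * (‖x₀ - s‖ / R))
    · filter_upwards [eventually_gt_atTop 0, eventually_ge_atTop ‖x₀ - s‖] with R hR hR'
      have := uav_shift hG2c hG2b hR 0 0 (x₀ - s) hR'
      rw [ech_zero_left, one_mul, zero_add, ← hq, ← hq, ← Complex.ofReal_sub,
        Complex.norm_real] at this
      exact this
    · have := (tendsto_const_nhds (x := ‖x₀ - s‖)).div_atTop (tendsto_id (α := ℝ) (x := atTop))
      simpa using this.const_mul (C ^ 2 * kT E)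
  refine ⟨vT E * (κ / 2) ^ 2 / 2 / S.card, by positivity, ?_⟩
  filter_upwards [hlim.eventually_lt_const (u := vT E * (κ / 2) ^ 2 / 2) (by positivity)] with r hr
  rw [Finset.sum_sub_distrib, Finset.sum_const, nsmul_eq_mul] at hr
  rw [div_le_iff₀ hcard]
  have := hlow r
  linarith

theorem tent_prod_lower {ξ z : E} (hξ : ‖ξ‖ ≤ 1 / 4) :
    (1 / 4) * tent ((4 : ℝ) • z) ≤ tent (ξ - z) * tent z := by
  by_cases hz : ‖z‖ < 1 / 4
  · have h1 := tent_ge (ξ - z)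
    have h2 := tent_ge z
    have h3 := norm_sub_le ξ z
    have h4 := tent_le_one ((4 : ℝ) • z)
    have : (1 / 2 : ℝ) * (1 / 2) ≤ tent (ξ - z) * tent z :=
      mul_le_mul (by linarith) (by linarith) (by norm_num) (tent_nonneg _)
    linarith
  · rw [tent_zero_of (by rw [norm_smul]; norm_num; linarith)]
    rw [mul_zero]
    exact mul_nonneg (tent_nonneg _) (tent_nonneg _)

theorem ap_unique (hG : Continuous G) (hC : ∀ t, ‖G t‖ ≤ C) (h : NetAP G)
    (h0 : ∀ η, Tendsto (fun R => uav G R η 0) atTop (𝓝 0)) (x₀ : E) : G x₀ = 0 := by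
  by_contra hx₀
  have hC0 : 0 ≤ C := (norm_nonneg _).trans (hC 0)
  have hv := vT_pos (E := E)
  obtain ⟨q, hq0, hq⟩ := qav_lower hG hC h hx₀
  set D := Module.finrank ℝ E with hD
  set c₀ : ℝ := (1 / 4) * ((1 / 4) ^ D * q) with hc₀
  have hc₀0 : 0 < c₀ := by positivity
  obtain ⟨S, hS⟩ := h (c₀ / (2 * (C * vT E + 1))) (by positivity)
  set a : ℝ≥0∞ := ENNReal.ofReal (c₀ / 2) ^ 2 * volume (ball (0 : E) (1 / 4)) with ha
  set b : ℝ≥0∞ := S.card * (ENNReal.ofReal C ^ 2 * volume (closedBall (0 : E) 1)) with hb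
  have hb' : b ≠ ⊤ := by
    have := (isCompact_closedBall (0 : E) 1).measure_lt_top (μ := volume)
    rw [hb]; finiteness
  have ha' : a ≠ 0 := by
    rw [ha]
    apply mul_ne_zero
    · apply pow_ne_zero
      simpa using hc₀0
    · exact (measure_ball_pos volume (0 : E) (by norm_num)).ne'
  have key : ∀ δ : ℝ, 0 < δ → a ≤ ENNReal.ofReal δ ^ 2 * b := by
    intro δ hδ
    have hq' : ∀ᶠ R in atTop, q ≤ qav G (R / 4) 0 :=
      (tendsto_id.atTop_div_const (by norm_num : (0 : ℝ) < 4)).eventually hq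
    obtain ⟨R, hRδ, hRq, hR0⟩ := ((uav_unif hG hC h h0 hδ).and
      (hq'.and (eventually_gt_atTop 0))).exists
    set g : E → ℂ := fun ξ => (tent ξ : ℂ) * G (R • ξ) with hg
    set f : E → E → ℂ := fun s ξ => (tent ξ : ℂ) * (starRingEnd ℂ) (G (s - R • ξ)) with hf
    have tc := tent_continuous (E := E)
    have ths : HasCompactSupport fun s : E => (tent s : ℂ) :=
      tent_hcs.comp_left (g := fun x : ℝ => (x : ℂ)) (by simp)
    have hconj : Continuous (starRingEnd ℂ) := Complex.continuous_conj
    have hgc : Continuous g := by fun_prop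
    have hgs : HasCompactSupport g := ths.mul_right
    have hfc : ∀ s, Continuous (f s) := fun s => by fun_prop
    have hfs : ∀ s, HasCompactSupport (f s) := fun s => ths.mul_right
    have hFg : ∀ χ, ‖𝓕 g χ‖ ≤ δ := by
      intro χ
      have : 𝓕 g χ = uav G R (R⁻¹ • χ) 0 := by
        rw [fourier_eq_ech, uav_def]
        congr 1; ext t
        have : ech (-(R⁻¹ • χ)) (R • t) = ech (-χ) t := by
          unfold ech
          rw [inner_neg_left, inner_neg_left, inner_smul_left, inner_smul_right]
          congr 4
          simp only [conj_trivial]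
          field_simp
        rw [this, hg, zero_add]
        ring
      rw [this]
      exact (hRδ _).le
    have hup : ∀ s, ∫⁻ x, ‖∫ y, f s y * g (x - y)‖ₑ ^ 2 ≤
        ENNReal.ofReal δ ^ 2 * (ENNReal.ofReal C ^ 2 * volume (closedBall (0 : E) 1)) := by
      intro s
      refine (conv_L2_le (hfc s) (hfs s) hgc hgs hFg).trans ?_
      gcongr
      rw [← setLIntegral_const, ← lintegral_indicator measurableSet_closedBall]
      apply lintegral_mono
      intro ξ
      by_cases hξ : ξ ∈ closedBall (0 : E) 1
      · simp only [Set.indicator_of_mem hξ]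
        gcongr
        rw [← ofReal_norm]
        apply ENNReal.ofReal_le_ofReal
        rw [hf, norm_mul, RCLike.norm_conj, Complex.norm_real,
          Real.norm_of_nonneg (tent_nonneg ξ)]
        calc tent ξ * ‖G (s - R • ξ)‖ ≤ 1 * C :=
              mul_le_mul (tent_le_one _) (hC _) (norm_nonneg _) zero_le_one
          _ = C := one_mul C
      · simp at hξ
        simp [hf, tent_zero_of hξ.le]
    have hlow : ∀ ξ ∈ ball (0 : E) (1 / 4), ∃ s ∈ S, c₀ / 2 ≤ ‖∫ y, f s y * g (ξ - y)‖ := by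
      intro ξ hξ
      simp only [mem_ball, dist_zero_right] at hξ
      obtain ⟨s, hs, hst⟩ := hS (R • ξ)
      refine ⟨s, hs, ?_⟩
      have hB : c₀ ≤ ∫ y, tent y * (tent (ξ - y) * ‖G (R • (ξ - y))‖ ^ 2) := by
        have e1 : ∫ y, tent y * (tent (ξ - y) * ‖G (R • (ξ - y))‖ ^ 2) =
            ∫ z, tent (ξ - z) * (tent z * ‖G (R • z)‖ ^ 2) := by
          rw [← integral_sub_left_eq_self _ volume ξ]
          simp
        have e2 : ∫ z : E, (1 / 4) * (tent ((4 : ℝ) • z) * ‖G (R • z)‖ ^ 2) =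
            (1 / 4) * ((1 / 4) ^ D * qav G (R / 4) 0) := by
          rw [integral_const_mul]
          congr 1
          have := Measure.integral_comp_smul (μ := (volume : Measure E))
            (fun z : E => tent z * ‖G ((R / 4) • z)‖ ^ 2) 4
          simp only [smul_smul] at this
          rw [show R / 4 * 4 = R by ring] at this
          rw [this, qav, smul_eq_mul, abs_of_pos (by positivity)]
          simp [hD]
        rw [e1]
        calc c₀ ≤ (1 / 4) * ((1 / 4) ^ D * qav G (R / 4) 0) := by rw [hc₀]; gcongr
          _ = _ := e2.symm
          _ ≤ _ := by
            apply integral_mono_of_nonneg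
            · refine Eventually.of_forall fun z => ?_
              have := tent_nonneg ((4 : ℝ) • z)
              simp only [Pi.zero_apply]
              positivity
            · have : Continuous fun z : E => tent (ξ - z) * ‖G (R • z)‖ ^ 2 := by fun_prop
              refine (tent_mul_integrable_real this).congr (Eventually.of_forall fun z => ?_)
              simp only
              ring
            · refine Eventually.of_forall fun z => ?_
              simp only
              have := mul_le_mul_of_nonneg_right (tent_prod_lower (z := z) hξ.le)
                (by positivity : 0 ≤ ‖G (R • z)‖ ^ 2)
              linarith
      have hdiff : ‖(∫ y, f s y * g (ξ - y)) -
          ((∫ y, tent y * (tent (ξ - y) * ‖G (R • (ξ - y))‖ ^ 2) : ℝ) : ℂ)‖ ≤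
          (c₀ / (2 * (C * vT E + 1)) * C) * vT E := by
        rw [← integral_complex_ofReal]
        have e1 : ∀ y, f s y * g (ξ - y) = (tent y : ℂ) * ((starRingEnd ℂ) (G (s - R • y)) *
            ((tent (ξ - y) : ℂ) * G (R • (ξ - y)))) := by
          intro y; simp only [hf, hg]; ring
        have e2 : ∀ y, ((tent y * (tent (ξ - y) * ‖G (R • (ξ - y))‖ ^ 2) : ℝ) : ℂ) =
            (tent y : ℂ) * ((starRingEnd ℂ) (G (R • (ξ - y))) *
            ((tent (ξ - y) : ℂ) * G (R • (ξ - y)))) := by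
          intro y
          have := Complex.conj_mul' (G (R • (ξ - y)))
          push_cast
          linear_combination -(tent y : ℂ) * (tent (ξ - y)) * this
        simp_rw [e1, e2]
        rw [← integral_sub (tent_mul_integrable (by fun_prop)) (tent_mul_integrable (by fun_prop))]
        simp_rw [← mul_sub, ← sub_mul]
        apply tent_mul_bound
        intro y
        rw [norm_mul, ← map_sub, RCLike.norm_conj, norm_mul, Complex.norm_real,
          Real.norm_of_nonneg (tent_nonneg _), norm_sub_rev]
        have h1 := hst (-(R • y))
        rw [← sub_eq_add_neg, ← sub_eq_add_neg, ← smul_sub] at h1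
        apply mul_le_mul h1 _ (mul_nonneg (tent_nonneg _) (norm_nonneg _)) (by positivity)
        calc tent (ξ - y) * ‖G (R • (ξ - y))‖ ≤ 1 * C :=
              mul_le_mul (tent_le_one _) (hC _) (norm_nonneg _) zero_le_one
          _ = C := one_mul C
      have hsm : (c₀ / (2 * (C * vT E + 1)) * C) * vT E ≤ c₀ / 2 := by
        have hpos : 0 < C * vT E + 1 := by positivity
        have : (c₀ / (2 * (C * vT E + 1)) * C) * vT E =
          (c₀ / 2) * ((C * vT E) / (C * vT E + 1)) := by field_simp
        rw [this]
        apply mul_le_of_le_one_right (by positivity)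
        rw [div_le_one hpos]; linarith
      set I := ∫ y, f s y * g (ξ - y)
      set B := ∫ y, tent y * (tent (ξ - y) * ‖G (R • (ξ - y))‖ ^ 2)
      have h1 := norm_sub_norm_le (B : ℂ) I
      rw [norm_sub_rev, Complex.norm_real, Real.norm_of_nonneg (hc₀0.le.trans hB)] at h1
      linarith
    calc a = ∫⁻ x in ball (0 : E) (1 / 4), ENNReal.ofReal (c₀ / 2) ^ 2 := by
          rw [setLIntegral_const]
      _ ≤ ∫⁻ x in ball (0 : E) (1 / 4), ∑ s ∈ S, ‖∫ y, f s y * g (x - y)‖ₑ ^ 2 := by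
          apply setLIntegral_mono' measurableSet_ball
          intro ξ hξ
          obtain ⟨s, hs, hle⟩ := hlow ξ hξ
          calc ENNReal.ofReal (c₀ / 2) ^ 2 ≤ ‖∫ y, f s y * g (ξ - y)‖ₑ ^ 2 := by
                gcongr
                rw [← ofReal_norm]
                exact ENNReal.ofReal_le_ofReal hle
            _ ≤ _ := Finset.single_le_sum
              (f := fun s => ‖∫ y, f s y * g (ξ - y)‖ₑ ^ 2) (fun _ _ => zero_le) hs
      _ ≤ ∫⁻ x, ∑ s ∈ S, ‖∫ y, f s y * g (x - y)‖ₑ ^ 2 := setLIntegral_le_lintegral _ _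
      _ = ∑ s ∈ S, ∫⁻ x, ‖∫ y, f s y * g (x - y)‖ₑ ^ 2 := by
          apply lintegral_finsetSum
          intro s _
          have : Continuous (f s ⋆[ContinuousLinearMap.mul ℂ ℂ] g) :=
            hgs.continuous_convolution_right _ (hfc s).locallyIntegrable hgc
          exact (this.enorm.measurable.pow_const 2)
      _ ≤ ∑ s ∈ S, ENNReal.ofReal δ ^ 2 * (ENNReal.ofReal C ^ 2 * volume (closedBall (0 : E) 1)) :=
          Finset.sum_le_sum fun s _ => hup s
      _ = ENNReal.ofReal δ ^ 2 * b := by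
          rw [Finset.sum_const, nsmul_eq_mul, hb]; ring
  have hlim : Tendsto (fun δ : ℝ => ENNReal.ofReal δ ^ 2 * b) (𝓝[>] 0) (𝓝 0) := by
    have h1 : Tendsto (fun δ : ℝ => ENNReal.ofReal δ ^ 2) (𝓝[>] 0) (𝓝 0) := by
      have : Continuous fun δ : ℝ => ENNReal.ofReal δ ^ 2 :=
        (ENNReal.continuous_pow 2).comp ENNReal.continuous_ofReal
      have := this.tendsto 0
      simp only [ENNReal.ofReal_zero] at this
      exact tendsto_nhdsWithin_of_tendsto_nhds (by simpa using this)
    simpa using ENNReal.Tendsto.mul_const h1 (Or.inr hb')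
  have : a ≤ 0 := ge_of_tendsto hlim (eventually_nhdsWithin_of_forall fun δ hδ => key δ hδ)
  exact ha' (le_antisymm this (zero_le))


/-! ### From Fourier transformability to translation boundedness -/

theorem l2_unif_bdd {ι X : Type*} [NormedAddCommGroup X] [NormedSpace ℂ X] [CompleteSpace X]
    (L : ι → X →L[ℂ] ℂ) (h : ∀ g, Summable fun i => ‖L i g‖ ^ 2) :
    ∃ A : ℝ, ∀ (F : Finset ι) (g : X), ∑ i ∈ F, ‖L i g‖ ^ 2 ≤ (A * ‖g‖) ^ 2 := by
  classical
  have hp : (0 : ℝ) < (2 : ℝ≥0∞).toReal := by norm_num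
  set T : Finset ι → X →L[ℂ] lp (fun _ : ι => ℂ) 2 := fun F =>
    ∑ i ∈ F, (lp.singleContinuousLinearMap ℂ (fun _ : ι => ℂ) 2 i).comp (L i) with hT
  have hn : ∀ F g, ‖T F g‖ ^ 2 = ∑ i ∈ F, ‖L i g‖ ^ 2 := by
    intro F g
    have := lp.norm_sum_single (E := fun _ : ι => ℂ) hp (fun i => L i g) F
    simp only [ENNReal.toReal_ofNat, Real.rpow_ofNat] at this
    rw [← this]
    congr 2
    simp [hT]
  obtain ⟨A, hA⟩ := banach_steinhaus (g := T) (fun g => by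
    refine ⟨√(∑' i, ‖L i g‖ ^ 2), fun F => ?_⟩
    apply Real.le_sqrt_of_sq_le
    rw [hn]
    exact (h g).sum_le_tsum F (fun _ _ => by positivity))
  refine ⟨A, fun F g => ?_⟩
  rw [← hn]
  gcongr
  exact (T F).le_of_opNorm_le (hA F) g

/-- The functional `g ↦ ∫ e_χ φ g`. -/
theorem exists_functional {φ : E → ℝ} (hφ : Continuous φ) (hφ' : HasCompactSupport φ) (χ : E) :
    ∃ L : BoundedContinuousFunction E ℂ →L[ℂ] ℂ, ∀ g, L g = 𝓕⁻ (fun s => (φ s : ℂ) * g s) χ := by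
  have hφs : HasCompactSupport fun s : E => (φ s : ℂ) :=
    hφ'.comp_left (g := fun x : ℝ => (x : ℂ)) (by simp)
  have hinteg : ∀ g : BoundedContinuousFunction E ℂ,
      Integrable fun s => ech χ s * ((φ s : ℂ) * g s) := fun g => by
    apply Continuous.integrable_of_hasCompactSupport (by fun_prop)
    exact (hφs.mul_right).mul_left
  have hφi : Integrable φ := hφ.integrable_of_hasCompactSupport hφ'
  refine ⟨LinearMap.mkContinuous
    { toFun := fun g => ∫ s, ech χ s * ((φ s : ℂ) * g s)
      map_add' := fun g g' => by
        rw [← integral_add (hinteg g) (hinteg g')]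
        congr 1; ext s
        simp only [BoundedContinuousFunction.coe_add, Pi.add_apply]; ring
      map_smul' := fun a g => by
        rw [RingHom.id_apply, smul_eq_mul, ← integral_const_mul]
        congr 1; ext s
        simp only [BoundedContinuousFunction.coe_smul, smul_eq_mul]; ring }
    (∫ s, ‖φ s‖) ?_, fun g => ?_⟩
  · intro g
    simp only [LinearMap.coe_mk, AddHom.coe_mk]
    rw [← integral_mul_const]
    apply norm_integral_le_of_norm_le (hφi.norm.mul_const _)
    refine Eventually.of_forall fun s => ?_
    rw [norm_mul, ech_norm, one_mul, norm_mul, Complex.norm_real]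
    gcongr
    exact g.norm_coe_le_norm s
  · rw [fourierInv_eq_ech]; rfl

theorem tb_of_summable (c : E → ℂ)
    (hs : ∀ f : E → ℂ, Continuous f → HasCompactSupport f →
      Summable fun χ => ‖c χ‖ * ‖𝓕⁻ f χ‖ ^ 2) {K : Set E} (hK : IsCompact K) :
    (⨆ t : E, ∑' χ : (t +ᵥ K : Set E), (‖c χ‖₊ : ℝ≥0∞)) < ⊤ := by
  obtain ⟨M, hM0, hM⟩ := hK.isBounded.exists_pos_norm_le
  set N : ℝ := 4 * Real.pi * M with hN
  have hpi := Real.pi_pos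
  have hN0 : 0 < N := by positivity
  set φ : E → ℝ := fun s => tent (N • s) with hφ
  have hφc : Continuous φ := by fun_prop
  have hφs : HasCompactSupport φ := tent_hcs.comp_smul hN0.ne'
  have hφi : Integrable φ := hφc.integrable_of_hasCompactSupport hφs
  have hφn : ∀ s, 0 ≤ φ s := fun s => tent_nonneg _
  set I := ∫ s, φ s with hI
  have hI0 : 0 < I := by
    apply hφc.integral_pos_of_hasCompactSupport_nonneg_nonzero hφs hφn (x := (0 : E))
    simp [hφ, tent]
  have hφcs : HasCompactSupport fun s : E => (φ s : ℂ) :=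
    hφs.comp_left (g := fun x : ℝ => (x : ℂ)) (by simp)
  have hlow : ∀ ξ : E, ‖ξ‖ ≤ M → I / 2 ≤ ‖𝓕⁻ (fun s => (φ s : ℂ)) ξ‖ := by
    intro ξ hξ
    have h1 : ‖𝓕⁻ (fun s => (φ s : ℂ)) ξ - (I : ℂ)‖ ≤ I / 2 := by
      rw [fourierInv_eq_ech, hI, ← integral_complex_ofReal, ← integral_sub]
      · rw [← integral_div]
        apply norm_integral_le_of_norm_le (hφi.div_const 2)
        refine Eventually.of_forall fun s => ?_
        rw [← sub_one_mul, norm_mul, Complex.norm_real, Real.norm_of_nonneg (hφn s)]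
        by_cases h : 1 ≤ ‖N • s‖
        · have : φ s = 0 := tent_zero_of h
          simp [this]
        · rw [norm_smul, Real.norm_of_nonneg hN0.le] at h
          have h2 := ech_sub_one_le ξ s
          have h3 : ‖ξ‖ * ‖s‖ ≤ M * ‖s‖ := by gcongr
          have : ‖ech ξ s - 1‖ ≤ 1 / 2 := by
            refine h2.trans ?_
            calc 2 * Real.pi * (‖ξ‖ * ‖s‖) ≤ 2 * Real.pi * (M * ‖s‖) := by gcongr
              _ = N * ‖s‖ / 2 := by rw [hN]; ring
              _ ≤ 1 / 2 := by linarith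
          calc _ ≤ 1 / 2 * φ s := mul_le_mul_of_nonneg_right this (hφn s)
            _ = φ s / 2 := by ring
      · exact Continuous.integrable_of_hasCompactSupport (by fun_prop) hφcs.mul_left
      · exact hφi.ofReal
    have h2 := norm_sub_norm_le (I : ℂ) (𝓕⁻ (fun s => (φ s : ℂ)) ξ)
    rw [norm_sub_rev, Complex.norm_real, Real.norm_of_nonneg hI0.le] at h2
    linarith
  choose L hL using fun χ : E => exists_functional hφc hφs χ
  obtain ⟨A, hA⟩ := l2_unif_bdd (fun χ : E => ((√‖c χ‖ : ℝ) : ℂ) • L χ) (fun g => by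
    refine (hs (fun s => (φ s : ℂ) * g s) (by fun_prop) hφcs.mul_right).congr fun χ => ?_
    rw [smul_apply, hL, norm_smul, mul_pow, Complex.norm_real,
      Real.norm_of_nonneg (Real.sqrt_nonneg _), Real.sq_sqrt (norm_nonneg _)])
  have hfin : ∀ (t : E) (F : Finset (t +ᵥ K : Set E)),
      ∑ χ ∈ F, ‖c χ‖ ≤ A ^ 2 / (I / 2) ^ 2 := by
    intro t F
    set g : BoundedContinuousFunction E ℂ := BoundedContinuousFunction.ofNormedAddCommGroup
      (fun s => ech (-t) s) (by fun_prop) 1 (fun s => (ech_norm _ _).le) with hg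
    have hg1 : ‖g‖ ≤ 1 := BoundedContinuousFunction.norm_ofNormedAddCommGroup_le _ zero_le_one _
    have h1 := hA (F.map ⟨Subtype.val, Subtype.val_injective⟩) g
    rw [Finset.sum_map] at h1
    have h2 : (A * ‖g‖) ^ 2 ≤ A ^ 2 := by
      rw [mul_pow]
      apply mul_le_of_le_one_right (sq_nonneg A)
      exact pow_le_one₀ (norm_nonneg _) hg1
    rw [le_div_iff₀ (by positivity), Finset.sum_mul]
    refine le_trans (Finset.sum_le_sum fun χ _ => ?_) (h1.trans h2)
    simp only [Function.Embedding.coeFn_mk]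
    rw [smul_apply, hL, norm_smul, mul_pow, Complex.norm_real,
      Real.norm_of_nonneg (Real.sqrt_nonneg _), Real.sq_sqrt (norm_nonneg _)]
    gcongr
    have e : 𝓕⁻ (fun s => (φ s : ℂ) * g s) χ = 𝓕⁻ (fun s => (φ s : ℂ)) (χ - t) := by
      rw [fourierInv_eq_ech, fourierInv_eq_ech]
      congr 1; ext s
      rw [sub_eq_add_neg, ech_add_left]
      simp only [hg, BoundedContinuousFunction.coe_ofNormedAddCommGroup]
      ring
    rw [e]
    apply hlow
    apply hM
    obtain ⟨k, hk, hk'⟩ := χ.2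
    rw [← hk']
    simpa using hk
  refine lt_of_le_of_lt (b := ENNReal.ofReal (A ^ 2 / (I / 2) ^ 2)) ?_ ENNReal.ofReal_lt_top
  apply iSup_le
  intro t
  rw [ENNReal.tsum_eq_iSup_sum]
  apply iSup_le
  intro F
  calc ∑ χ ∈ F, (‖c χ‖₊ : ℝ≥0∞) = ENNReal.ofReal (∑ χ ∈ F, ‖c χ‖) := by
        rw [ENNReal.ofReal_sum_of_nonneg (fun _ _ => norm_nonneg _)]
        exact Finset.sum_congr rfl fun _ _ => (ofReal_norm _).symm
    _ ≤ _ := ENNReal.ofReal_le_ofReal (hfin t F)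

/-! ### Summability from translation boundedness -/

theorem cs_set {B : Set E} {u : E → ℝ≥0∞} (hu : Measurable u) :
    (∫⁻ z in B, u z) ^ 2 ≤ volume B * ∫⁻ z in B, u z ^ 2 := by
  have h := ENNReal.lintegral_mul_le_Lp_mul_Lq (volume.restrict B)
    (Real.HolderConjugate.two_two) (f := fun _ => (1 : ℝ≥0∞)) (g := u)
    aemeasurable_const hu.aemeasurable
  simp only [Pi.mul_apply, one_mul, lintegral_const, Measure.restrict_apply_univ,
    ENNReal.rpow_ofNat] at h
  calc (∫⁻ z in B, u z) ^ 2 ≤ _ := pow_le_pow_left' h 2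
    _ = _ := by
      have e : ∀ x : ℝ≥0∞, (x ^ (1 / 2 : ℝ)) ^ 2 = x := fun x => by
        rw [← ENNReal.rpow_natCast, ← ENNReal.rpow_mul]
        norm_num
      rw [mul_pow, e, e, one_pow, one_mul]

theorem summable_of_tb (c : E → ℂ)
    (hs : ∀ K : Set E, IsCompact K →
      (⨆ t : E, ∑' χ : (t +ᵥ K : Set E), (‖c χ‖₊ : ℝ≥0∞)) < ⊤)
    {f : E → ℂ} (hf : Continuous f) (hf' : HasCompactSupport f) :
    Summable fun χ => ‖c χ‖ * ‖𝓕⁻ f χ‖ ^ 2 := by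
  obtain ⟨M, hM0, hM⟩ := hf'.isCompact.isBounded.exists_pos_norm_le
  have hpi := Real.pi_pos
  set ρ : ℝ := 1 / (4 * Real.pi * M) with hρ
  have hρ0 : 0 < ρ := by positivity
  set B := ball (0 : E) ρ with hB
  set N := (⨆ t : E, ∑' χ : (t +ᵥ closedBall (0 : E) ρ : Set E), (‖c χ‖₊ : ℝ≥0∞)) with hN
  have hN' : N < ⊤ := hs _ (isCompact_closedBall _ _)
  have hVt : volume B < ⊤ := measure_ball_lt_top
  set V := (volume B).toReal with hV
  have hV0 : 0 < V := ENNReal.toReal_pos (measure_ball_pos _ _ hρ0).ne' hVt.ne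
  have : IsFiniteMeasure (volume.restrict B) := ⟨by simpa using hVt⟩
  set k : E → ℂ := fun t => ∫ z in B, ech z t with hk
  have hkc : Continuous k := by
    refine continuous_of_dominated (bound := fun _ => 1) ?_ ?_ (integrable_const _) ?_
    · exact fun t => (Continuous.aestronglyMeasurable (by fun_prop))
    · exact fun t => Eventually.of_forall fun z => (ech_norm _ _).le
    · exact Eventually.of_forall fun z => by fun_prop
  have hk0 : ∀ t ∈ tsupport f, k t ≠ 0 := by
    intro t ht h0
    have h1 : ‖k t - (V : ℂ)‖ ≤ 1 / 2 * V := by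
      have e : (V : ℂ) = ∫ z in B, (1 : ℂ) := by
        rw [setIntegral_const]; simp [hV, Measure.real]
      rw [e, hk]
      rw [← integral_sub]
      · apply norm_setIntegral_le_of_norm_le_const hVt
        intro z hz
        simp only [hB, mem_ball, dist_zero_right] at hz
        refine (ech_sub_one_le z t).trans ?_
        have := hM t ht
        calc 2 * Real.pi * (‖z‖ * ‖t‖) ≤ 2 * Real.pi * (ρ * M) := by gcongr
          _ = 1 / 2 := by rw [hρ]; field_simp; norm_num
      · exact (integrable_const (1 : ℝ)).mono' (Continuous.aestronglyMeasurable (by fun_prop))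
          (Eventually.of_forall fun z => (ech_norm _ _).le)
      · exact integrable_const _
    rw [h0, zero_sub, norm_neg, Complex.norm_real, Real.norm_of_nonneg hV0.le] at h1
    linarith
  set f1 : E → ℂ := fun t => f t * (k t)⁻¹ with hf1
  have hsub : tsupport f1 ⊆ tsupport f := by
    apply closure_mono
    intro t ht h0
    apply ht
    simp [hf1, h0]
  have hf1s : HasCompactSupport f1 := hf'.mul_right
  have hf1c : Continuous f1 := by
    apply continuous_of_tsupport
    intro t ht
    exact hf.continuousAt.mul (hkc.continuousAt.inv₀ (hk0 t (hsub ht)))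
  have hf1i : Integrable f1 := hf1c.integrable_of_hasCompactSupport hf1s
  have hff : ∀ t, f t = f1 t * k t := by
    intro t
    by_cases ht : t ∈ tsupport f
    · simp only [hf1]
      field_simp [hk0 t ht]
    · have := image_eq_zero_of_notMem_tsupport ht
      simp [hf1, this]
  set u : E → ℂ := fun χ => 𝓕⁻ f1 χ with hu
  have huc : Continuous u := by
    have := (ech_continuous_fourier hf1i).comp continuous_neg
    refine this.congr fun χ => ?_
    simp [hu, fourierInv_eq_fourier]
  have hrep : ∀ χ, 𝓕⁻ f χ = ∫ z in B, u (χ + z) := by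
    intro χ
    simp only [hu]
    simp_rw [fourierInv_eq_ech]
    rw [integral_integral_swap]
    · congr 1; ext t
      simp_rw [ech_add_left]
      rw [hff, hk]
      rw [← integral_const_mul, ← integral_const_mul]
      congr 1; ext z; ring
    · have h1 := ((integrable_const (1 : ℝ)).mul_prod hf1i.norm :
        Integrable _ ((volume.restrict B).prod volume))
      refine h1.mono' (Continuous.aestronglyMeasurable (by fun_prop)) ?_
      refine Eventually.of_forall fun p => ?_
      simp [Function.uncurry, ech_norm]
  have hpt : ∀ χ, ‖𝓕⁻ f χ‖ₑ ^ 2 ≤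
      volume B * ∫⁻ y, B.indicator (fun _ => 1) (y - χ) * ‖u y‖ₑ ^ 2 := by
    intro χ
    rw [hrep]
    calc _ ≤ (∫⁻ z in B, ‖u (χ + z)‖ₑ) ^ 2 :=
          pow_le_pow_left' (enorm_integral_le_lintegral_enorm _) 2
      _ ≤ volume B * ∫⁻ z in B, ‖u (χ + z)‖ₑ ^ 2 :=
          cs_set (u := fun z => ‖u (χ + z)‖ₑ) (by
            have : Continuous fun z => u (χ + z) := by fun_prop
            exact this.enorm.measurable)
      _ = _ := by
        congr 1
        rw [← lintegral_indicator measurableSet_ball, ← lintegral_sub_right_eq_self _ χ]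
        congr 1; ext y
        by_cases hy : y - χ ∈ B
        · rw [Set.indicator_of_mem hy, Set.indicator_of_mem hy]
          simp
        · rw [Set.indicator_of_notMem hy, Set.indicator_of_notMem hy, zero_mul]
  have hmeas : ∀ χ, Measurable fun y => B.indicator (fun _ => (1 : ℝ≥0∞)) (y - χ) * ‖u y‖ₑ ^ 2 := by
    intro χ
    have h1 : Measurable (B.indicator (fun _ => (1 : ℝ≥0∞))) :=
      measurable_const.indicator measurableSet_ball
    exact (h1.comp (measurable_id.sub_const χ)).mul (huc.enorm.measurable.pow_const 2)
  have hcount : ∀ (s : Finset E) (y : E),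
      ∑ χ ∈ s, (‖c χ‖₊ : ℝ≥0∞) * B.indicator (fun _ => (1 : ℝ≥0∞)) (y - χ) ≤ N := by
    intro s y
    refine le_trans ?_ (le_iSup _ y)
    rw [tsum_subtype (y +ᵥ closedBall (0 : E) ρ) (fun χ => (‖c χ‖₊ : ℝ≥0∞))]
    refine le_trans (Finset.sum_le_sum fun χ _ => ?_) (ENNReal.sum_le_tsum s)
    by_cases hy : y - χ ∈ B
    · have : χ ∈ y +ᵥ closedBall (0 : E) ρ := by
        refine ⟨χ - y, ?_, by simp⟩
        simp only [hB, mem_ball, dist_zero_right] at hy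
        simp only [mem_closedBall, dist_zero_right]
        rw [norm_sub_rev]
        exact hy.le
      rw [Set.indicator_of_mem this, Set.indicator_of_mem hy, mul_one]
    · simp [hy]
  have hpl : ∫⁻ y, ‖u y‖ₑ ^ 2 < ⊤ := by
    have e : ∫⁻ y, ‖u y‖ₑ ^ 2 = ∫⁻ t, ‖f1 t‖ₑ ^ 2 := by
      rw [← plancherel hf1c hf1s, ← lintegral_neg_eq_self]
      simp [hu, fourierInv_eq_fourier]
    rw [e, lintegral_sq_eq_eLpNorm]
    have := (hf1c.memLp_of_hasCompactSupport hf1s (p := 2) (μ := volume)).2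
    exact ENNReal.pow_lt_top this
  have htot : ∑' χ, (‖c χ‖₊ : ℝ≥0∞) * ‖𝓕⁻ f χ‖ₑ ^ 2 ≤
      volume B * ∫⁻ y, N * ‖u y‖ₑ ^ 2 := by
    rw [ENNReal.tsum_eq_iSup_sum]
    apply iSup_le
    intro s
    calc ∑ χ ∈ s, (‖c χ‖₊ : ℝ≥0∞) * ‖𝓕⁻ f χ‖ₑ ^ 2
        ≤ ∑ χ ∈ s, (‖c χ‖₊ : ℝ≥0∞) *
          (volume B * ∫⁻ y, B.indicator (fun _ => 1) (y - χ) * ‖u y‖ₑ ^ 2) :=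
          Finset.sum_le_sum fun χ _ => mul_le_mul_right (hpt χ) _
      _ = volume B * ∑ χ ∈ s,
          ∫⁻ y, (‖c χ‖₊ : ℝ≥0∞) * (B.indicator (fun _ => 1) (y - χ) * ‖u y‖ₑ ^ 2) := by
          rw [Finset.mul_sum]
          refine Finset.sum_congr rfl fun χ _ => ?_
          rw [lintegral_const_mul _ (hmeas χ)]
          ring
      _ = volume B * ∫⁻ y, ∑ χ ∈ s,
          (‖c χ‖₊ : ℝ≥0∞) * (B.indicator (fun _ => 1) (y - χ) * ‖u y‖ₑ ^ 2) := by
          rw [lintegral_finsetSum]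
          exact fun χ _ => (hmeas χ).const_mul _
      _ ≤ _ := by
          gcongr with y
          simp_rw [← mul_assoc]
          rw [← Finset.sum_mul]
          gcongr
          exact hcount s y
  have hfin : ∑' χ, (‖c χ‖₊ : ℝ≥0∞) * ‖𝓕⁻ f χ‖ₑ ^ 2 ≠ ⊤ := by
    refine (htot.trans_lt ?_).ne
    rw [lintegral_const_mul _ (huc.enorm.measurable.pow_const 2)]
    exact ENNReal.mul_lt_top hVt (ENNReal.mul_lt_top hN' hpl)
  refine (ENNReal.summable_toReal hfin).congr fun χ => ?_
  simp

/-! ### Almost periodic series -/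

theorem NetAP.add {G₁ G₂ : E → ℂ} (h₁ : NetAP G₁) (h₂ : NetAP G₂) :
    NetAP fun t => G₁ t + G₂ t := by
  classical
  intro ε hε
  obtain ⟨S₁, hS₁⟩ := h₁ (ε / 4) (by positivity)
  obtain ⟨S₂, hS₂⟩ := h₂ (ε / 4) (by positivity)
  set P : E × E → E → Prop := fun p x => (∀ t, ‖G₁ (x + t) - G₁ (p.1 + t)‖ ≤ ε / 4) ∧
    (∀ t, ‖G₂ (x + t) - G₂ (p.2 + t)‖ ≤ ε / 4) with hP
  set rep : E × E → E := fun p => if h : ∃ x, P p x then h.choose else 0 with hrep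
  refine ⟨(S₁ ×ˢ S₂).image rep, fun x => ?_⟩
  obtain ⟨s₁, hs₁, h1⟩ := hS₁ x
  obtain ⟨s₂, hs₂, h2⟩ := hS₂ x
  refine ⟨rep (s₁, s₂), Finset.mem_image_of_mem _ (Finset.mk_mem_product hs₁ hs₂), fun t => ?_⟩
  have hex : ∃ x, P (s₁, s₂) x := ⟨x, h1, h2⟩
  have hr : P (s₁, s₂) (rep (s₁, s₂)) := by
    simp only [hrep, dif_pos hex]
    exact hex.choose_spec
  set r := rep (s₁, s₂)
  have a1 := h1 t
  have a2 := h2 t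
  have b1 := hr.1 t
  have b2 := hr.2 t
  rw [norm_sub_rev] at b1 b2
  have e : G₁ (x + t) + G₂ (x + t) - (G₁ (r + t) + G₂ (r + t)) =
      ((G₁ (x + t) - G₁ (s₁ + t)) + (G₁ (s₁ + t) - G₁ (r + t))) +
      ((G₂ (x + t) - G₂ (s₂ + t)) + (G₂ (s₂ + t) - G₂ (r + t))) := by ring
  rw [e]
  refine (norm_add_le _ _).trans ?_
  refine (add_le_add (norm_add_le _ _) (norm_add_le _ _)).trans ?_
  simp only at b1 b2
  linarith

theorem NetAP.neg {G₁ : E → ℂ} (h₁ : NetAP G₁) : NetAP fun t => -G₁ t := by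
  intro ε hε
  obtain ⟨S, hS⟩ := h₁ ε hε
  refine ⟨S, fun x => ?_⟩
  obtain ⟨s, hs, h⟩ := hS x
  refine ⟨s, hs, fun t => ?_⟩
  have := h t
  rw [← norm_neg] at this
  rwa [show -G₁ (x + t) - -G₁ (s + t) = -(G₁ (x + t) - G₁ (s + t)) by ring]

theorem NetAP.approx {G₁ : E → ℂ}
    (h : ∀ ε > 0, ∃ G₂ : E → ℂ, NetAP G₂ ∧ ∀ t, ‖G₂ t - G₁ t‖ ≤ ε) : NetAP G₁ := by
  intro ε hε
  obtain ⟨G₂, h2, h3⟩ := h (ε / 3) (by positivity)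
  obtain ⟨S, hS⟩ := h2 (ε / 3) (by positivity)
  refine ⟨S, fun x => ?_⟩
  obtain ⟨s, hs, h⟩ := hS x
  refine ⟨s, hs, fun t => ?_⟩
  have a1 := h t
  have a2 := h3 (x + t)
  have a3 := h3 (s + t)
  rw [norm_sub_rev] at a2
  have e : G₁ (x + t) - G₁ (s + t) = (G₁ (x + t) - G₂ (x + t)) + (G₂ (x + t) - G₂ (s + t)) +
    (G₂ (s + t) - G₁ (s + t)) := by ring
  rw [e]
  refine norm_add₃_le.trans ?_
  linarith

theorem NetAP.ech (a : ℂ) (χ : E) : NetAP fun t => a * ech χ t := by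
  classical
  intro ε hε
  have htb : TotallyBounded (Set.range fun t => a * _root_.ech χ t) := by
    apply (isCompact_closedBall (0 : ℂ) ‖a‖).totallyBounded.subset
    rintro _ ⟨t, rfl⟩
    simp [ech_norm]
  obtain ⟨T, hT, hfin, hcov⟩ := Metric.finite_approx_of_totallyBounded htb ε hε
  obtain ⟨T', rfl⟩ := hfin.exists_finset_coe
  obtain ⟨S, -, rfl⟩ := (Finset.subset_set_image_iff (s := Set.univ)
    (f := fun t => a * _root_.ech χ t) (t := T')).1 (by rw [Set.image_univ]; exact hT)
  refine ⟨S, fun x => ?_⟩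
  have hx := hcov ⟨x, rfl⟩
  simp only [Set.mem_iUnion, mem_ball, dist_eq_norm, exists_prop, Finset.mem_coe,
    Finset.mem_image] at hx
  obtain ⟨_, ⟨s, hs, rfl⟩, hlt⟩ := hx
  refine ⟨s, hs, fun t => ?_⟩
  simp only
  rw [ech_add_right, ech_add_right, ← mul_assoc, ← mul_assoc, ← sub_mul, norm_mul, ech_norm,
    mul_one]
  exact hlt.le

theorem NetAP.sum {ι : Type*} (F : Finset ι) {g : ι → E → ℂ} (h : ∀ i, NetAP (g i)) :
    NetAP fun t => ∑ i ∈ F, g i t := by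
  classical
  induction F using Finset.induction_on with
  | empty =>
    intro ε hε
    exact ⟨{0}, fun x => ⟨0, by simp, fun t => by simpa using hε.le⟩⟩
  | insert i F hi ih =>
    simp_rw [Finset.sum_insert hi]
    exact (h i).add ih

/-- Characters as bounded continuous functions. -/
def eB (χ : E) : BoundedContinuousFunction E ℂ := BoundedContinuousFunction.ofNormedAddCommGroup
  (fun s => ech χ s) (by fun_prop) 1 (fun s => (ech_norm _ _).le)

theorem eB_apply (χ s : E) : eB χ s = ech χ s := rfl

theorem eB_norm (χ : E) : ‖eB χ‖ ≤ 1 :=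
  BoundedContinuousFunction.norm_ofNormedAddCommGroup_le _ zero_le_one _

theorem summable_eB {a : E → ℂ} (ha : Summable fun χ => ‖a χ‖) (R : ℝ) :
    Summable fun χ => a χ • eB (R • χ) := by
  apply Summable.of_norm_bounded ha
  intro χ
  rw [norm_smul]
  exact mul_le_of_le_one_right (norm_nonneg _) (eB_norm _)

theorem tsum_eB_apply {a : E → ℂ} (ha : Summable fun χ => ‖a χ‖) (R : ℝ) (s : E) :
    (∑' χ, a χ • eB (R • χ)) s = ∑' χ, a χ * ech χ (R • s) := by
  have := ((BoundedContinuousFunction.evalCLM ℂ s).hasSum (summable_eB ha R).hasSum).tsum_eq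
  rw [BoundedContinuousFunction.evalCLM_apply] at this
  rw [← this]
  congr 1; ext χ
  simp [eB_apply, ech, inner_smul_left, inner_smul_right]

theorem uav_series {a : E → ℂ} (ha : Summable fun χ => ‖a χ‖) (R : ℝ) (η : E) :
    uav (fun t => ∑' χ, a χ * ech χ t) R η 0 =
      ∑' χ, a χ * 𝓕⁻ (fun s : E => (tent s : ℂ)) (R • (χ - η)) := by
  obtain ⟨L, hL⟩ := exists_functional (tent_continuous (E := E)) tent_hcs (-(R • η))
  have h1 : uav (fun t => ∑' χ, a χ * ech χ t) R η 0 = L (∑' χ, a χ • eB (R • χ)) := by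
    rw [hL, fourierInv_eq_ech, uav_def]
    congr 1; ext s
    rw [tsum_eB_apply ha, zero_add]
    have : ech (-η) (R • s) = ech (-(R • η)) s := by
      simp [ech, inner_smul_left, inner_smul_right]
    rw [this]
    ring
  rw [h1, ← (L.hasSum (summable_eB ha R).hasSum).tsum_eq]
  congr 1; ext χ
  rw [map_smul, hL, smul_eq_mul, fourierInv_eq_ech, fourierInv_eq_ech]
  congr 2; ext s
  rw [eB_apply, smul_sub, sub_eq_add_neg, ech_add_left]
  ring

theorem uav_series_tendsto {a : E → ℂ} (ha : Summable fun χ => ‖a χ‖) (η : E) :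
    Tendsto (fun R => uav (fun t => ∑' χ, a χ * ech χ t) R η 0) atTop (𝓝 (a η * vT E)) := by
  classical
  simp_rw [uav_series ha]
  have h1 : a η * vT E = ∑' χ, a χ * (if χ = η then (vT E : ℂ) else 0) := by
    rw [tsum_eq_single η]
    · simp
    · intro χ hχ; simp [hχ]
  rw [h1]
  apply tendsto_tsum_of_dominated_convergence (bound := fun χ => ‖a χ‖ * vT E) (ha.mul_right _)
  · intro χ
    apply Tendsto.const_mul
    split_ifs with h
    · have : ∀ R : ℝ, 𝓕⁻ (fun s : E => (tent s : ℂ)) (R • (χ - η)) = vT E := by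
        intro R
        rw [h, sub_self, smul_zero, fourierInv_eq_ech, vT, ← integral_complex_ofReal]
        simp [ech_zero_left]
      simp_rw [this]
      exact tendsto_const_nhds
    · have hRL := tendsto_integral_exp_inner_smul_cocompact (fun s : E => (tent s : ℂ))
      have hco : Tendsto (fun R : ℝ => R • (η - χ)) atTop (cocompact E) := by
        rw [← cobounded_eq_cocompact, ← comap_norm_atTop, tendsto_comap_iff]
        simp only [Function.comp_def]
        simp_rw [norm_smul]
        apply Tendsto.atTop_mul_const
        · exact norm_pos_iff.2 (sub_ne_zero.2 fun h' => h h'.symm)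
        · exact tendsto_norm_atTop_atTop
      refine (hRL.comp hco).congr fun R => ?_
      rw [fourierInv_eq_fourier, ← smul_neg, neg_sub]
      rfl
  · refine Eventually.of_forall fun R χ => ?_
    rw [norm_mul]
    gcongr
    rw [fourierInv_eq_ech]
    simp_rw [mul_comm (ech _ _)]
    have := tent_mul_bound (H := fun s : E => ech (R • (χ - η)) s) (D := 1)
      (fun s => (ech_norm _ _).le)
    simpa using this

theorem series_continuous {a : E → ℂ} (ha : Summable fun χ => ‖a χ‖) :
    Continuous fun t => ∑' χ, a χ * ech χ t :=
  continuous_tsum (fun χ => by fun_prop) ha fun χ t => by simp [ech_norm]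

theorem series_bound {a : E → ℂ} (ha : Summable fun χ => ‖a χ‖) (t : E) :
    ‖∑' χ, a χ * ech χ t‖ ≤ ∑' χ, ‖a χ‖ :=
  tsum_of_norm_bounded ha.hasSum fun χ => by simp [ech_norm]

theorem series_netAP {a : E → ℂ} (ha : Summable fun χ => ‖a χ‖) :
    NetAP fun t => ∑' χ, a χ * ech χ t := by
  apply NetAP.approx
  intro ε hε
  have h1 := (summable_eB ha 1).hasSum
  have h2 := (Metric.tendsto_nhds.1 h1 ε hε).exists
  obtain ⟨F, hF⟩ := h2
  refine ⟨fun t => ∑ χ ∈ F, a χ * ech χ t, NetAP.sum F fun χ => NetAP.ech _ _, fun t => ?_⟩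
  rw [dist_eq_norm] at hF
  have h3 := BoundedContinuousFunction.norm_coe_le_norm
    (∑ χ ∈ F, a χ • eB ((1 : ℝ) • χ) - ∑' χ, a χ • eB ((1 : ℝ) • χ)) t
  rw [BoundedContinuousFunction.sub_apply, tsum_eB_apply ha, one_smul] at h3
  refine le_trans (le_of_eq ?_) (h3.trans hF.le)
  congr 2
  rw [BoundedContinuousFunction.sum_apply]
  simp [eB_apply]

/-! ### Tent averages of measures -/

theorem tent_layer (x : E) {R : ℝ} (hR : 0 < R) :
    ∫ r in Set.Ioo (0 : ℝ) 1, (if ‖x‖ < r * R then (1 : ℂ) else 0) = (tent (R⁻¹ • x) : ℂ) := by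
  have e : ∀ r : ℝ, (if ‖x‖ < r * R then (1 : ℂ) else 0) =
      (Set.Ioi (‖x‖ / R)).indicator (fun _ => (1 : ℂ)) r := by
    intro r
    rw [Set.indicator_apply]
    simp only [Set.mem_Ioi, div_lt_iff₀ hR]
  simp_rw [e]
  rw [setIntegral_indicator measurableSet_Ioi, setIntegral_const]
  have h0 : 0 ≤ ‖x‖ / R := by positivity
  have e2 : Set.Ioo (0 : ℝ) 1 ∩ Set.Ioi (‖x‖ / R) = Set.Ioo (‖x‖ / R) 1 := by
    ext r
    simp only [Set.mem_inter_iff, Set.mem_Ioo, Set.mem_Ioi]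
    constructor
    · rintro ⟨⟨_, h1⟩, h2⟩; exact ⟨h2, h1⟩
    · rintro ⟨h2, h1⟩; exact ⟨⟨h0.trans_lt h2, h1⟩, h2⟩
  rw [e2, Measure.real, Real.volume_Ioo, ENNReal.toReal_ofReal', tent, norm_smul, norm_inv,
    Real.norm_of_nonneg hR.le, max_comm]
  simp only [Complex.real_smul, mul_one]
  congr 3
  field_simp

theorem layer (ν : Measure E) [IsFiniteMeasureOnCompacts ν] (η : E) {R : ℝ} (hR : 0 < R) :
    AEStronglyMeasurable (fun r : ℝ => ∫ x in ball (0 : E) (r * R), ech (-η) x ∂ν)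
      (volume.restrict (Set.Ioo (0 : ℝ) 1)) ∧
    ∫ x, (tent (R⁻¹ • x) : ℂ) * ech (-η) x ∂ν =
      ∫ r in Set.Ioo (0 : ℝ) 1, ∫ x in ball (0 : E) (r * R), ech (-η) x ∂ν := by
  set ν' := ν.restrict (ball (0 : E) R) with hν'
  have : IsFiniteMeasure ν' := ⟨by
    rw [hν', Measure.restrict_apply_univ]; exact measure_ball_lt_top⟩
  set Φ : ℝ → E → ℂ := fun r x => (if ‖x‖ < r * R then (1 : ℂ) else 0) * ech (-η) x with hΦ
  have hmeas : Measurable (Function.uncurry Φ) := by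
    apply Measurable.mul
    · refine Measurable.ite ?_ measurable_const measurable_const
      exact (isOpen_lt (by fun_prop) (by fun_prop)).measurableSet
    · exact Continuous.measurable (by fun_prop)
  have hinteg : Integrable (Function.uncurry Φ) ((volume.restrict (Set.Ioo (0 : ℝ) 1)).prod ν') := by
    refine (integrable_const (1 : ℝ)).mono' hmeas.aestronglyMeasurable
      (Eventually.of_forall fun p => ?_)
    simp only [Function.uncurry, hΦ, norm_mul, ech_norm, mul_one]
    split_ifs <;> simp
  have hin : ∀ r ∈ Set.Ioo (0 : ℝ) 1, ∫ x, Φ r x ∂ν' = ∫ x in ball (0 : E) (r * R), ech (-η) x ∂ν := by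
    intro r hr
    have hsub : ball (0 : E) (r * R) ⊆ ball 0 R := ball_subset_ball (by nlinarith [hr.1, hr.2])
    have e : ∀ x, Φ r x = (ball (0 : E) (r * R)).indicator (fun x => ech (-η) x) x := by
      intro x
      by_cases hx : ‖x‖ < r * R
      · rw [Set.indicator_of_mem (by simpa using hx)]
        simp [hΦ, hx]
      · rw [Set.indicator_of_notMem (by simpa using hx)]
        simp [hΦ, hx]
    simp_rw [e]
    rw [integral_indicator measurableSet_ball, hν', Measure.restrict_restrict measurableSet_ball,
      Set.inter_eq_left.2 hsub]
  constructor
  · refine (hinteg.aestronglyMeasurable.integral_prod_right').congr ?_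
    exact (ae_restrict_mem measurableSet_Ioo).mono fun r hr => hin r hr
  · rw [← setIntegral_congr_fun measurableSet_Ioo hin, integral_integral_swap hinteg]
    have e1 : ∀ x, ∫ r in Set.Ioo (0 : ℝ) 1, Φ r x = (tent (R⁻¹ • x) : ℂ) * ech (-η) x := by
      intro x
      rw [← tent_layer x hR, ← integral_mul_const]
    simp_rw [e1]
    rw [hν', setIntegral_eq_integral_of_forall_compl_eq_zero]
    intro x hx
    rw [tent_zero_of]
    · simp
    · simp only [mem_ball, dist_zero_right, not_lt] at hx
      rw [norm_smul, norm_inv, Real.norm_of_nonneg hR.le, inv_mul_eq_div]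
      exact (one_le_div hR).2 hx

theorem vol_ball_scale {r : ℝ} (hr : 0 < r) : (volume (ball (0 : E) r)).toReal =
    r ^ Module.finrank ℝ E * (volume (ball (0 : E) 1)).toReal := by
  rw [Measure.addHaar_ball_of_pos _ _ hr, ENNReal.toReal_mul, ENNReal.toReal_ofReal (by positivity)]

theorem vol_ball_one_pos : 0 < (volume (ball (0 : E) 1)).toReal :=
  ENNReal.toReal_pos (measure_ball_pos _ _ one_pos).ne' measure_ball_lt_top.ne

theorem vT_layer : (vT E : ℂ) =
    ∫ r in Set.Ioo (0 : ℝ) 1, (((volume (ball (0 : E) r)).toReal : ℝ) : ℂ) := by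
  have h := (layer (volume : Measure E) 0 one_pos).2
  simp only [inv_one, one_smul, mul_one, neg_zero, ech_zero_left, setIntegral_const] at h
  rw [vT, ← integral_complex_ofReal, h]
  simp [Measure.real]

theorem growth {μ : Measure E} [IsFiniteMeasureOnCompacts μ] {c : ℂ}
    (hc : Tendsto (fun R : ℝ => ((volume (ball (0 : E) R)).toReal)⁻¹ •
      ∫ t in ball (0 : E) R, ech (-(0 : E)) t ∂μ) atTop (𝓝 c)) :
    ∃ D : ℝ, ∀ᶠ R : ℝ in atTop, (μ (ball (0 : E) R)).toReal ≤ D * R ^ Module.finrank ℝ E := by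
  have hv := vol_ball_one_pos (E := E)
  refine ⟨(‖c‖ + 1) * (volume (ball (0 : E) 1)).toReal, ?_⟩
  filter_upwards [hc.norm.eventually_lt_const (lt_add_one ‖c‖), eventually_gt_atTop 0] with R h hR
  simp only [neg_zero, ech_zero_left, setIntegral_const, Measure.real] at h
  rw [norm_smul, norm_smul, norm_one, mul_one, norm_inv, Real.norm_of_nonneg ENNReal.toReal_nonneg,
    Real.norm_of_nonneg ENNReal.toReal_nonneg, vol_ball_scale hR, inv_mul_lt_iff₀ (by positivity)] at h
  linarith

theorem tent_avg {μ : Measure E} [IsFiniteMeasureOnCompacts μ] {c : E → ℂ}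
    (hc : ∀ χ, Tendsto (fun R : ℝ => ((volume (ball (0 : E) R)).toReal)⁻¹ •
      ∫ t in ball (0 : E) R, ech (-χ) t ∂μ) atTop (𝓝 (c χ))) (η : E) :
    Tendsto (fun R : ℝ => (R ^ Module.finrank ℝ E)⁻¹ •
      ∫ x, (tent (R⁻¹ • x) : ℂ) * ech (-η) x ∂μ) atTop (𝓝 (vT E * c η)) := by
  have hv := vol_ball_one_pos (E := E)
  obtain ⟨D, hD⟩ := growth (hc 0)
  rw [vT_layer, ← integral_mul_const]
  have key : Tendsto (fun R : ℝ => ∫ r in Set.Ioo (0 : ℝ) 1, (R ^ Module.finrank ℝ E)⁻¹ •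
      ∫ x in ball (0 : E) (r * R), ech (-η) x ∂μ) atTop
      (𝓝 (∫ r in Set.Ioo (0 : ℝ) 1, (((volume (ball (0 : E) r)).toReal : ℝ) : ℂ) * c η)) := by
    apply tendsto_integral_filter_of_dominated_convergence (fun _ => D)
    · filter_upwards [eventually_gt_atTop 0] with R hR
      exact (layer μ η hR).1.const_smul ((R ^ Module.finrank ℝ E)⁻¹)
    · filter_upwards [eventually_gt_atTop 0, hD] with R hR hRD
      refine (ae_restrict_mem measurableSet_Ioo).mono fun r hr => ?_
      have hsub : ball (0 : E) (r * R) ⊆ ball 0 R := ball_subset_ball (by nlinarith [hr.1, hr.2])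
      have h1 : ‖∫ x in ball (0 : E) (r * R), ech (-η) x ∂μ‖ ≤ 1 * (μ (ball (0 : E) (r * R))).toReal :=
        norm_setIntegral_le_of_norm_le_const measure_ball_lt_top fun x _ => (ech_norm _ _).le
      have h2 : (μ (ball (0 : E) (r * R))).toReal ≤ (μ (ball (0 : E) R)).toReal :=
        ENNReal.toReal_mono measure_ball_lt_top.ne (measure_mono hsub)
      rw [norm_smul, norm_inv, Real.norm_of_nonneg (by positivity), inv_mul_le_iff₀ (by positivity)]
      linarith
    · exact integrable_const _
    · refine (ae_restrict_mem measurableSet_Ioo).mono fun r hr => ?_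
      have h1 := (hc η).comp (tendsto_id.const_mul_atTop hr.1)
      have h2 := h1.const_mul (((volume (ball (0 : E) r)).toReal : ℝ) : ℂ)
      refine h2.congr' ?_
      filter_upwards [eventually_gt_atTop 0] with R hR
      simp only [Function.comp_apply, id]
      rw [vol_ball_scale (mul_pos hr.1 hR), vol_ball_scale hr.1, Complex.real_smul,
        Complex.real_smul, ← mul_assoc, ← Complex.ofReal_mul]
      congr 2
      have := hr.1
      rw [mul_pow]
      field_simp
  refine key.congr' ?_
  filter_upwards [eventually_gt_atTop 0] with R hR
  rw [(layer μ η hR).2, integral_smul]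

theorem meas_ball_tail {μ : Measure E} {D : ℝ}
    (hD : ∀ᶠ R : ℝ in atTop, (μ (ball (0 : E) R)).toReal ≤ D * R ^ Module.finrank ℝ E) (a b : ℝ) :
    Tendsto (fun R : ℝ => (R ^ Module.finrank ℝ E)⁻¹ * (a / R) * (μ (ball (0 : E) (R + b))).toReal)
      atTop (𝓝 0) := by
  have h1 : Tendsto (fun R : ℝ => |a| / R * (D * (1 + b / R) ^ Module.finrank ℝ E)) atTop (𝓝 0) := by
    have e1 : Tendsto (fun R : ℝ => |a| / R) atTop (𝓝 0) := tendsto_const_nhds.div_atTop tendsto_id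
    have e2 : Tendsto (fun R : ℝ => b / R) atTop (𝓝 0) := tendsto_const_nhds.div_atTop tendsto_id
    have e3 := e1.mul (((e2.const_add 1).pow (Module.finrank ℝ E)).const_mul D)
    simpa using e3
  refine squeeze_zero_norm' ?_ h1
  have hD' := (tendsto_atTop_add_const_right atTop b tendsto_id).eventually hD
  filter_upwards [eventually_gt_atTop 0, hD'] with R hR h
  simp only [id] at h
  rw [norm_mul, norm_mul, norm_inv, norm_div, Real.norm_of_nonneg (by positivity : 0 ≤ R ^ _),
    Real.norm_of_nonneg hR.le, Real.norm_of_nonneg ENNReal.toReal_nonneg, Real.norm_eq_abs]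
  have : D * (1 + b / R) ^ Module.finrank ℝ E = (R ^ Module.finrank ℝ E)⁻¹ *
      (D * (R + b) ^ Module.finrank ℝ E) := by
    have : R + b = R * (1 + b / R) := by field_simp
    rw [this, mul_pow]
    field_simp
  rw [this]
  calc _ ≤ (R ^ Module.finrank ℝ E)⁻¹ * (|a| / R) * (D * (R + b) ^ Module.finrank ℝ E) := by gcongr
    _ = _ := by ring

theorem uav_measure {μ : Measure E} [IsFiniteMeasureOnCompacts μ] {c : E → ℂ}
    (hc : ∀ χ, Tendsto (fun R : ℝ => ((volume (ball (0 : E) R)).toReal)⁻¹ •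
      ∫ t in ball (0 : E) R, ech (-χ) t ∂μ) atTop (𝓝 (c χ))) (η : E)
    {k : E → ℂ} (hk : Continuous k) (hk' : HasCompactSupport k) :
    Tendsto (fun R : ℝ => uav (fun t => ∫ x, k (t - x) ∂μ) R η 0) atTop
      (𝓝 (vT E * c η * 𝓕 k η)) := by
  obtain ⟨D, hD⟩ := growth (hc 0)
  obtain ⟨b, hb0, hb⟩ := hk'.isCompact.isBounded.exists_pos_norm_le
  have hkz : ∀ u, b < ‖u‖ → k u = 0 := by
    intro u hu
    apply image_eq_zero_of_notMem_tsupport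
    intro h
    exact (hb u h).not_gt hu
  set n := Module.finrank ℝ E with hn
  have hki : Integrable k := hk.integrable_of_hasCompactSupport hk'
  set a : ℝ := b * ∫ u, ‖k u‖ with ha
  have hlim := ((tent_avg hc η).mul_const (𝓕 k η))
  have herr := meas_ball_tail hD a (b + 1)
  have hdiff : Tendsto (fun R : ℝ => uav (fun t => ∫ x, k (t - x) ∂μ) R η 0 -
      ((R ^ n)⁻¹ • ∫ x, (tent (R⁻¹ • x) : ℂ) * ech (-η) x ∂μ) * 𝓕 k η) atTop (𝓝 0) := by
    refine squeeze_zero_norm' ?_ herr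
    filter_upwards [eventually_gt_atTop 0] with R hR
    have hRn : 0 < R ^ n := by positivity
    -- inner function
    have hcont : Continuous (Function.uncurry fun s x : E =>
        (tent s : ℂ) * (k (R • s - x) * ech (-η) (R • s))) := by
      have := tent_continuous (E := E)
      fun_prop
    have hsupp : HasCompactSupport (Function.uncurry fun s x : E =>
        (tent s : ℂ) * (k (R • s - x) * ech (-η) (R • s))) := by
      apply HasCompactSupport.of_support_subset_isCompact
        ((isCompact_closedBall (0 : E) 1).prod (isCompact_closedBall (0 : E) (R + b)))
      rintro ⟨s, x⟩ h
      simp only [Function.uncurry, Function.mem_support, ne_eq] at h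
      have h1 : ‖s‖ ≤ 1 := by
        by_contra h1
        exact h (by rw [tent_zero_of (not_le.1 h1).le]; simp)
      have h2 : ‖R • s - x‖ ≤ b := by
        by_contra h2
        exact h (by rw [hkz _ (not_le.1 h2)]; simp)
      refine ⟨by simpa using h1, ?_⟩
      simp only [mem_closedBall, dist_zero_right]
      have h3 : ‖R • s‖ ≤ R := by
        rw [norm_smul, Real.norm_of_nonneg hR.le]; nlinarith
      calc ‖x‖ = ‖R • s - (R • s - x)‖ := by congr 1; abel
        _ ≤ _ := norm_sub_le _ _
        _ ≤ _ := add_le_add h3 h2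
    set J : E → ℂ := fun x => ∫ s, (tent s : ℂ) * (k (R • s - x) * ech (-η) (R • s)) with hJ
    have hJi : Integrable J μ :=
      (hcont.integrable_of_hasCompactSupport hsupp (μ := volume.prod μ)).integral_prod_right
    have hTi : Integrable (fun x => (R ^ n)⁻¹ • ((tent (R⁻¹ • x) : ℂ) * ech (-η) x) * 𝓕 k η) μ := by
      apply Continuous.integrable_of_hasCompactSupport
      · have := tent_continuous (E := E)
        fun_prop
      · have h1 : HasCompactSupport fun x : E => tent (R⁻¹ • x) :=
          tent_hcs.comp_smul (inv_ne_zero hR.ne')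
        have h2 : HasCompactSupport fun x : E => (tent (R⁻¹ • x) : ℂ) :=
          h1.comp_left (g := fun x : ℝ => (x : ℂ)) (by simp)
        exact ((h2.mul_right).smul_left (f := fun _ => (R ^ n)⁻¹)).mul_right
    have e1 : uav (fun t => ∫ x, k (t - x) ∂μ) R η 0 = ∫ x, J x ∂μ := by
      rw [hJ, ← integral_integral_swap_of_hasCompactSupport hcont hsupp, uav_def]
      congr 1; ext s
      rw [zero_add, ← integral_mul_const, ← integral_const_mul]
    have e2 : ∀ x, J x = (R ^ n)⁻¹ • (ech (-η) x *
        ∫ u, (tent (R⁻¹ • (u + x)) : ℂ) * (k u * ech (-η) u)) := by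
      intro x
      have := Measure.integral_comp_inv_smul (volume : Measure E)
        (fun s => (tent s : ℂ) * (k (R • s - x) * ech (-η) (R • s))) R
      rw [abs_of_pos hRn] at this
      rw [eq_inv_smul_iff₀ hRn.ne', hJ, ← this, ← integral_add_right_eq_self _ x,
        ← integral_const_mul]
      congr 1; ext u
      rw [smul_smul, mul_inv_cancel₀ hR.ne', one_smul, ech_add_right]
      simp only [add_sub_cancel_right]
      ring
    have e3 : ∀ x, (R ^ n)⁻¹ • ((tent (R⁻¹ • x) : ℂ) * ech (-η) x) * 𝓕 k η = (R ^ n)⁻¹ • (ech (-η) x *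
        ∫ u, (tent (R⁻¹ • x) : ℂ) * (k u * ech (-η) u)) := by
      intro x
      rw [integral_const_mul, fourier_eq_ech]
      simp_rw [mul_comm (k _)]
      simp only [Complex.real_smul]
      ring
    have htR : ∀ x : E, R ≤ ‖x‖ → tent (R⁻¹ • x) = 0 := by
      intro x hx
      apply tent_zero_of
      rw [norm_smul, norm_inv, Real.norm_of_nonneg hR.le, inv_mul_eq_div]
      exact (one_le_div hR).2 hx
    have hbd : ∀ x, ‖J x - (R ^ n)⁻¹ • ((tent (R⁻¹ • x) : ℂ) * ech (-η) x) * 𝓕 k η‖ ≤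
        (R ^ n)⁻¹ * (a / R) := by
      intro x
      rw [e2, e3, ← smul_sub, ← mul_sub, norm_smul, norm_mul, ech_norm, one_mul, norm_inv,
        Real.norm_of_nonneg hRn.le]
      gcongr
      have hi : ∀ x' : E → E, Continuous x' →
          Integrable fun u => (tent (R⁻¹ • x' u) : ℂ) * (k u * ech (-η) u) := by
        intro x' hx'
        apply Continuous.integrable_of_hasCompactSupport
        · have := tent_continuous (E := E)
          fun_prop
        · exact hk'.mul_right.mul_left
      rw [← integral_sub (hi (fun u => u + x) (by fun_prop)) (hi (fun _ => x) (by fun_prop)), ha,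
        mul_div_right_comm, ← integral_const_mul]
      apply norm_integral_le_of_norm_le (hki.norm.const_mul _)
      refine Eventually.of_forall fun u => ?_
      rw [← sub_mul, norm_mul, norm_mul, ech_norm, mul_one, ← Complex.ofReal_sub,
        Complex.norm_real, Real.norm_eq_abs]
      by_cases hu : b < ‖u‖
      · rw [hkz u hu]; simp
      · gcongr
        refine (tent_lip _ _).trans ?_
        rw [← smul_sub, add_sub_cancel_right, norm_smul, norm_inv, Real.norm_of_nonneg hR.le,
          inv_mul_eq_div]
        gcongr
        exact not_lt.1 hu
    have hzero : ∀ x, x ∉ ball (0 : E) (R + (b + 1)) →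
        J x - (R ^ n)⁻¹ • ((tent (R⁻¹ • x) : ℂ) * ech (-η) x) * 𝓕 k η = 0 := by
      intro x hx
      simp only [mem_ball, dist_zero_right, not_lt] at hx
      have h1 : ∀ u, (tent (R⁻¹ • (u + x)) : ℂ) * (k u * ech (-η) u) = 0 := by
        intro u
        by_cases hu : b < ‖u‖
        · rw [hkz u hu]; simp
        · rw [htR]
          · simp
          · have h3 : ‖x‖ ≤ ‖u + x‖ + ‖u‖ := by
              calc ‖x‖ = ‖(u + x) - u‖ := by congr 1; abel
                _ ≤ _ := norm_sub_le _ _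
            linarith
      rw [e2, htR x (by linarith)]
      simp_rw [h1]
      simp
    have e4 : ((R ^ n)⁻¹ • ∫ x, (tent (R⁻¹ • x) : ℂ) * ech (-η) x ∂μ) * 𝓕 k η =
        ∫ x, (R ^ n)⁻¹ • ((tent (R⁻¹ • x) : ℂ) * ech (-η) x) * 𝓕 k η ∂μ := by
      rw [integral_mul_const, integral_smul]
    rw [e1, e4, ← integral_sub hJi hTi, ← setIntegral_eq_integral_of_forall_compl_eq_zero hzero]
    exact norm_setIntegral_le_of_norm_le_const measure_ball_lt_top fun x _ => hbd x
  have := hdiff.add hlim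
  rw [zero_add] at this
  refine this.congr fun R => ?_
  rw [hn]
  ring

/-! ### The correlation function -/

theorem exists_corr {f : E → ℂ} (hf : Continuous f) (hf' : HasCompactSupport f) :
    ∃ k : E → ℂ, Continuous k ∧ HasCompactSupport k ∧
      (∀ t, k (0 - t) = ∫ s, f s * (starRingEnd ℂ) (f (s - t))) ∧
      ∀ χ, 𝓕 k χ = (‖𝓕⁻ f χ‖ : ℂ) ^ 2 := by
  set f₁ : E → ℂ := fun s => f (-s) with hf₁
  set f₂ : E → ℂ := fun s => (starRingEnd ℂ) (f s) with hf₂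
  have h1 : Continuous f₁ := by fun_prop
  have h1' : HasCompactSupport f₁ := hf'.comp_homeomorph (Homeomorph.neg E)
  have h2 : Continuous f₂ := Complex.continuous_conj.comp hf
  have h2' : HasCompactSupport f₂ := hf'.comp_left (g := starRingEnd ℂ) (map_zero _)
  have i1 : Integrable f₁ := h1.integrable_of_hasCompactSupport h1'
  have i2 : Integrable f₂ := h2.integrable_of_hasCompactSupport h2'
  refine ⟨f₁ ⋆[ContinuousLinearMap.mul ℂ ℂ] f₂,
    h2'.continuous_convolution_right _ h1.locallyIntegrable h2, h1'.convolution _ h2', ?_, ?_⟩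
  · intro t
    rw [convolution, ← integral_neg_eq_self]
    congr 1; ext s
    simp only [hf₁, hf₂, ContinuousLinearMap.mul_apply', neg_neg]
    congr 3
    abel
  · intro χ
    rw [Real.fourier_mul_convolution_eq i1 i2 χ]
    have e1 : 𝓕 f₁ χ = 𝓕⁻ f χ := by
      rw [fourier_eq_ech, fourierInv_eq_ech, ← integral_neg_eq_self]
      congr 1; ext s
      simp [hf₁, ech_neg_right]
    have e2 : 𝓕 f₂ χ = (starRingEnd ℂ) (𝓕⁻ f χ) := by
      rw [fourier_eq_ech, fourierInv_eq_ech, ← integral_conj]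
      congr 1; ext s
      simp [hf₂, ech_conj]
    rw [e1, e2, Complex.mul_conj']

theorem identity_of_summable {μ : Measure E} [IsFiniteMeasureOnCompacts μ] {c : E → ℂ}
    (hc : ∀ χ, Tendsto (fun R : ℝ => ((volume (ball (0 : E) R)).toReal)⁻¹ •
      ∫ t in ball (0 : E) R, ech (-χ) t ∂μ) atTop (𝓝 (c χ)))
    {k : E → ℂ} (hk : Continuous k) (hk' : HasCompactSupport k)
    (hF : Continuous fun t => ∫ x, k (t - x) ∂μ) {C : ℝ} (hC : ∀ t, ‖∫ x, k (t - x) ∂μ‖ ≤ C)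
    (hAP : NetAP fun t => ∫ x, k (t - x) ∂μ) (hs : Summable fun χ => ‖c χ * 𝓕 k χ‖) :
    ∫ x, k (0 - x) ∂μ = ∑' χ, c χ * 𝓕 k χ := by
  set F : E → ℂ := fun t => ∫ x, k (t - x) ∂μ with hFd
  set P : E → ℂ := fun t => ∑' χ, (c χ * 𝓕 k χ) * ech χ t with hP
  have hPc : Continuous P := series_continuous hs
  have hPb := series_bound hs
  have hPap : NetAP P := series_netAP hs
  have hu : ∀ R η, uav (fun t => F t + -P t) R η 0 = uav F R η 0 - uav P R η 0 := by
    intro R η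
    rw [uav_def, uav_def, uav_def, ← integral_sub (tent_mul_integrable (by fun_prop))
      (tent_mul_integrable (by fun_prop))]
    congr 1; ext s
    ring
  have h := ap_unique (G := fun t => F t + -P t) (C := C + ∑' χ, ‖c χ * 𝓕 k χ‖)
    (hF.add hPc.neg) (fun t => by
      refine (norm_add_le _ _).trans ?_
      rw [norm_neg]
      exact add_le_add (hC t) (hPb t)) (hAP.add hPap.neg) (fun η => by
      simp_rw [hu]
      have h1 := (uav_measure hc η hk hk').sub (uav_series_tendsto hs η)
      have e : (vT E : ℂ) * c η * 𝓕 k η - c η * 𝓕 k η * vT E = 0 := by ring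
      rw [e] at h1
      exact h1) 0
  have h2 : F 0 = P 0 := by
    linear_combination h
  simp only [hFd, hP, ech_zero_right, mul_one] at h2
  exact h2

end Helpers

/-- **main theorem.** Let `μ` be a positive, translation bounded, strongly almost
periodic Radon measure on `ℝ^d` with Fourier–Bohr coefficients `c`. Then `c` is translation
bounded if and only if `μ` is Fourier transformable with Fourier transform the Fourier–Bohr
series `∑_χ c(χ) δ_χ`. -/
theorem fourierTransformable_sap_stmt6 {d : ℕ}
    (μ : Measure (EuclideanSpace ℝ (Fin d))) [μ.Regular]
    (hTB : ∀ K : Set (EuclideanSpace ℝ (Fin d)), IsCompact K →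
      (⨆ x : EuclideanSpace ℝ (Fin d), μ (x +ᵥ K)) < ⊤)
    (hSAP : ∀ f : EuclideanSpace ℝ (Fin d) → ℂ, Continuous f → HasCompactSupport f →
      IsBohrAlmostPeriodic fun t => ∫ x, f (t - x) ∂μ)
    (c : EuclideanSpace ℝ (Fin d) → ℂ)
    (hc : ∀ χ : EuclideanSpace ℝ (Fin d), IsFourierBohrCoeff μ χ (c χ)) :
    (∀ K : Set (EuclideanSpace ℝ (Fin d)), IsCompact K →
      (⨆ t : EuclideanSpace ℝ (Fin d),
        ∑' χ : (t +ᵥ K : Set (EuclideanSpace ℝ (Fin d))), (‖c χ‖₊ : ℝ≥0∞)) < ⊤) ↔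
    (∀ f : EuclideanSpace ℝ (Fin d) → ℂ, Continuous f → HasCompactSupport f →
      (Summable fun χ : EuclideanSpace ℝ (Fin d) => ‖c χ‖ * ‖𝓕⁻ f χ‖ ^ 2) ∧
      ∫ t, (∫ s, f s * (starRingEnd ℂ) (f (s - t))) ∂μ
        = ∑' χ : EuclideanSpace ℝ (Fin d), c χ * (‖𝓕⁻ f χ‖ : ℂ) ^ 2) := by
  have hc' : ∀ χ, Tendsto (fun R : ℝ =>
      ((volume (ball (0 : EuclideanSpace ℝ (Fin d)) R)).toReal)⁻¹ •
      ∫ t in ball (0 : EuclideanSpace ℝ (Fin d)) R, ech (-χ) t ∂μ) atTop (𝓝 (c χ)) := by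
    intro χ
    have h := hc χ
    unfold IsFourierBohrCoeff at h
    refine h.congr fun R => ?_
    congr 2; ext t
    simp [ech]
  constructor
  · intro ha f hf hf'
    have hsum := summable_of_tb c ha hf hf'
    refine ⟨hsum, ?_⟩
    obtain ⟨k, hk, hk', hk0, hkF⟩ := exists_corr hf hf'
    obtain ⟨hF, ⟨C, hC⟩, hAP⟩ := hSAP k hk hk'
    have hnet : NetAP fun t => ∫ x, k (t - x) ∂μ := by
      classical
      intro ε hε
      obtain ⟨S, hS⟩ := hAP ε hε
      refine ⟨S.image fun s => -s, fun x => ?_⟩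
      obtain ⟨s, hs, h⟩ := hS (-x)
      refine ⟨-s, Finset.mem_image_of_mem _ hs, fun t => ?_⟩
      have := h t
      simp only at this ⊢
      rw [show x + t = t - -x by abel, show -s + t = t - s by abel]
      exact this
    have hs : Summable fun χ => ‖c χ * 𝓕 k χ‖ := by
      refine hsum.congr fun χ => ?_
      rw [hkF]
      simp
    have := identity_of_summable hc' hk hk' hF hC hnet hs
    simp_rw [hk0, hkF] at this
    exact this
  · intro hb K hK
    exact tb_of_summable c (fun f hf hf' => (hb f hf hf').1) hK
end
end
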